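/- arXiv:1509.07803 — 3 statements merged into one kernel-verified Lean document; each statement's English description precedes it below -/
import Mathlib

section
/- Let n, m ≥ 1 be integers, let A = ℂ[x₁,…,xₙ] be the polynomial ring equipped with a ℤ-grading making it a graded ℂ-algebra, and let f ∈ A be homogeneous of degree m and irreducible as an element of A. Let ℓ, ℓ' ≥ 1 be integers both coprime with m, and let ℓ'' ≥ 1 be an integer with ℓ'' ≡ −ℓ' (mod m). If the ℂ-algebras R_{f,ℓ} and R_{f,ℓ'} are isomorphic, then the K-algebras Y_ℓ and Y_{ℓ'} are isomorphic, or the K-algebras Y_ℓ and Y_{ℓ''} are isomorphic. -/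
open LaurentPolynomial

/-- The coordinate ring `Y_j = K[x₁,…,xₙ]/(t^j · f_K - 1)` of the curve `{f = t^{-j}}`
over `K = ℂ(t)`, the generic fiber of the projection `X̃_{f,j} → 𝔸¹_*`. -/
noncomputable abbrev genericFiberRing (n : ℕ) (f : MvPolynomial (Fin n) ℂ) (j : ℤ) : Type :=
  MvPolynomial (Fin n) (RatFunc ℂ) ⧸
    Ideal.span {MvPolynomial.C ((RatFunc.X : RatFunc ℂ) ^ j) *
      MvPolynomial.map (algebraMap ℂ (RatFunc ℂ)) f - 1}

section GradedTwist

variable {k A B : Type*} [CommRing k] [CommRing A] [Algebra k A] [CommRing B] [Algebra k B]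

/-- The algebra homomorphism sending a homogeneous element `a` of degree `d` to `u ^ d * g a`. -/
noncomputable def gradedTwist (𝒜 : ℤ → Submodule k A) [GradedAlgebra 𝒜] (g : A →ₐ[k] B) (u : Bˣ) :
    A →ₐ[k] B :=
  (DirectSum.toAlgebra k (fun i => 𝒜 i)
    (fun i => (LinearMap.mulLeft k ((u ^ i : Bˣ) : B)).comp (g.toLinearMap.comp (𝒜 i).subtype))
    (by
      change ((u ^ (0 : ℤ) : Bˣ) : B) * g 1 = 1
      simp)
    (by
      intro i j a b
      change ((u ^ (i + j) : Bˣ) : B) * g ((a : A) * b) =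
        ((u ^ i : Bˣ) : B) * g a * (((u ^ j : Bˣ) : B) * g b)
      rw [zpow_add, map_mul, Units.val_mul]
      ring)).comp (DirectSum.decomposeAlgEquiv 𝒜).toAlgHom

variable (𝒜 : ℤ → Submodule k A) [GradedAlgebra 𝒜]

theorem gradedTwist_of_mem (g : A →ₐ[k] B) (u : Bˣ) {d : ℤ} {a : A} (ha : a ∈ 𝒜 d) :
    gradedTwist 𝒜 g u a = ((u ^ d : Bˣ) : B) * g a := by
  rw [gradedTwist, AlgHom.comp_apply]
  change DirectSum.toAlgebra k (fun i => 𝒜 i) _ _ _ (DirectSum.decompose 𝒜 a) = _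
  rw [DirectSum.decompose_of_mem 𝒜 ha, DirectSum.toAlgebra_apply]
  exact DirectSum.toAddMonoid_of (fun i => (LinearMap.mulLeft k ((u ^ i : Bˣ) : B) ∘ₗ
    g.toLinearMap ∘ₗ (𝒜 i).subtype).toAddMonoidHom) d ⟨a, ha⟩

theorem algHom_ext_of_homogeneous {g h : A →ₐ[k] B} (hgh : ∀ d, ∀ a ∈ 𝒜 d, g a = h a) : g = h := by
  ext a
  induction a using DirectSum.Decomposition.inductionOn 𝒜 with
  | zero => simp
  | homogeneous a => exact hgh _ _ a.2
  | add a b ha hb => simp [ha, hb]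

end GradedTwist

section LaurentUnits

namespace LaurentPolynomial

variable {R : Type*} [CommRing R]

/-- The variable of a Laurent polynomial ring, as a unit. -/
noncomputable def unitT (R : Type*) [CommRing R] : (R[T;T⁻¹])ˣ :=
  ⟨T 1, T (-1), by rw [← T_add]; simp, by rw [← T_add]; simp⟩

theorem unitT_zpow (n : ℤ) : ((unitT R ^ n : (R[T;T⁻¹])ˣ) : R[T;T⁻¹]) = T n := by
  induction n using Int.induction_on with
  | zero => simp
  | succ i hi => rw [zpow_add_one, Units.val_mul, hi]; exact (T_add _ _).symm
  | pred i hi => rw [zpow_sub_one, Units.val_mul, hi]; exact (T_add _ _).symm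

theorem coeff_C_mul_T (r : R) (n e : ℤ) : (C r * T n).coeff e = if n = e then r else 0 := by
  rw [← single_eq_C_mul_T, AddMonoidAlgebra.coeff_single, Finsupp.single_apply]

theorem exists_eq_C_mul_T_of_isUnit [IsDomain R]
    {p : R[T;T⁻¹]} (hp : IsUnit p) : ∃ (r : R) (n : ℤ), p = C r * T n := by
  obtain ⟨q, hpq⟩ := hp.exists_right_inv
  obtain ⟨a, p', hp'⟩ := exists_T_pow p
  obtain ⟨b, q', hq'⟩ := exists_T_pow q
  have h : p' * q' = Polynomial.X ^ (a + b) := by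
    apply Polynomial.toLaurent_injective
    rw [map_mul, hp', hq', Polynomial.toLaurent_X_pow, Nat.cast_add, T_add]
    linear_combination (T a * T b : R[T;T⁻¹]) * hpq
  obtain ⟨i, -, hi⟩ := (dvd_prime_pow Polynomial.prime_X _).1 (Dvd.intro _ h)
  obtain ⟨v, hv⟩ := hi.symm
  obtain ⟨r, -, hr⟩ := Polynomial.isUnit_iff.1 v.isUnit
  refine ⟨r, i - a, ?_⟩
  have : p = p * T a * T (-a) := by rw [mul_T_assoc]; simp
  rw [this, ← hp', ← hv, ← hr, map_mul, Polynomial.toLaurent_X_pow, Polynomial.toLaurent_C,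
    sub_eq_add_neg, T_add]
  ring

end LaurentPolynomial

end LaurentUnits

section Hypersurface

variable {k A : Type*} [CommRing k] [CommRing A] [Algebra k A]

/-- The ring `R_{f,ℓ} = A[T,T⁻¹]/(T^ℓ f - 1)`. -/
abbrev HypersurfaceRing (f : A) (ℓ : ℤ) : Type _ :=
  A[T;T⁻¹] ⧸ Ideal.span {T ℓ * C f - 1}

namespace HypersurfaceRing

/-- The unit of `R_{f,ℓ}` given by the class of `T`. -/
noncomputable def unitT (f : A) (ℓ : ℤ) : (HypersurfaceRing f ℓ)ˣ :=
  Units.map (Ideal.Quotient.mk (Ideal.span {T ℓ * C f - 1})).toMonoidHom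
    (LaurentPolynomial.unitT A)

theorem unitT_zpow (f : A) (ℓ n : ℤ) :
    ((unitT f ℓ ^ n : (HypersurfaceRing f ℓ)ˣ) : HypersurfaceRing f ℓ) =
      Ideal.Quotient.mk _ (T n) := by
  rw [unitT, ← map_zpow]
  exact congrArg (Ideal.Quotient.mk _) (LaurentPolynomial.unitT_zpow n)

theorem algebraMap_apply (f : A) (ℓ : ℤ) (a : A) :
    algebraMap A (HypersurfaceRing f ℓ) a = Ideal.Quotient.mk _ (C a) := rfl

theorem unitT_zpow_mul_algebraMap (f : A) (ℓ : ℤ) :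
    ((unitT f ℓ ^ ℓ : (HypersurfaceRing f ℓ)ˣ) : HypersurfaceRing f ℓ) * algebraMap A _ f = 1 := by
  rw [unitT_zpow, algebraMap_apply, ← map_mul, ← sub_eq_zero, ← map_one (Ideal.Quotient.mk _),
    ← map_sub, Ideal.Quotient.eq_zero_iff_mem]
  exact Ideal.mem_span_singleton_self _

variable {B : Type*} [CommRing B] [Algebra k B]

/-- The universal property of `R_{f,ℓ}`. -/
noncomputable def lift (f : A) (ℓ : ℤ) (g : A →ₐ[k] B) (u : Bˣ)
    (hu : ((u ^ ℓ : Bˣ) : B) * g f = 1) : HypersurfaceRing f ℓ →ₐ[k] B :=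
  Ideal.Quotient.liftₐ _
    { eval₂ (g : A →+* B) u with
      commutes' := fun c => by
        change eval₂ (g : A →+* B) u (algebraMap k A[T;T⁻¹] c) = _
        rw [IsScalarTower.algebraMap_apply k A, ← C_eq_algebraMap]
        simp }
    (fun a ha => by
      have h : Ideal.span {T ℓ * C f - 1} ≤ RingHom.ker (eval₂ (g : A →+* B) u) := by
        rw [Ideal.span_singleton_le_iff_mem, RingHom.mem_ker]
        rw [map_sub, map_mul, eval₂_T, eval₂_C, map_one, sub_eq_zero]
        exact hu
      exact h ha)

variable (f : A) (ℓ : ℤ) (g : A →ₐ[k] B) (u : Bˣ) (hu : ((u ^ ℓ : Bˣ) : B) * g f = 1)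

@[simp]
theorem lift_algebraMap (a : A) : lift f ℓ g u hu (algebraMap A _ a) = g a :=
  eval₂_C (g : A →+* B) u a

@[simp]
theorem lift_unitT_zpow (n : ℤ) :
    lift f ℓ g u hu ((unitT f ℓ ^ n : (HypersurfaceRing f ℓ)ˣ)) = ((u ^ n : Bˣ) : B) := by
  rw [unitT_zpow]
  exact eval₂_T (g : A →+* B) u n

@[elab_as_elim]
theorem induction_on {f : A} {ℓ : ℤ}
    {motive : HypersurfaceRing f ℓ → Prop}
    (r : HypersurfaceRing f ℓ)
    (monomial : ∀ (a : A) (n : ℤ),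
      motive (algebraMap A (HypersurfaceRing f ℓ) a * ((unitT f ℓ ^ n : (HypersurfaceRing f ℓ)ˣ))))
    (add : ∀ r s, motive r → motive s → motive (r + s)) : motive r := by
  obtain ⟨p, rfl⟩ := Ideal.Quotient.mk_surjective r
  induction p using LaurentPolynomial.induction_on' with
  | add p q hp hq => rw [map_add]; exact add _ _ hp hq
  | C_mul_T n a =>
    rw [map_mul, ← unitT_zpow, ← algebraMap_apply]
    exact monomial a n

theorem algHom_ext' {g h : HypersurfaceRing f ℓ →ₐ[k] B}
    (hc : ∀ a, g (algebraMap A _ a) = h (algebraMap A _ a))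
    (hT : g (unitT f ℓ) = h (unitT f ℓ)) : g = h := by
  have hT' : Units.map (g : HypersurfaceRing f ℓ →* B) (unitT f ℓ) =
      Units.map (h : HypersurfaceRing f ℓ →* B) (unitT f ℓ) := Units.ext hT
  refine AlgHom.ext fun r => ?_
  induction r using induction_on with
  | add r s hr hs => rw [map_add, map_add, hr, hs]
  | monomial a n =>
    have := congrArg (fun v : Bˣ => ((v ^ n : Bˣ) : B)) hT'
    simp only [← map_zpow, Units.coe_map] at this
    rw [map_mul, map_mul, hc]
    congr 1

section Domain

theorem irreducible_X_pow_sub_C_of_prime [IsDomain A] {f : A} (hf : Prime f) {N : ℕ} (hN : N ≠ 0) :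
    Irreducible (Polynomial.X ^ N - Polynomial.C f : Polynomial A) := by
  have hmonic := Polynomial.monic_X_pow_sub_C f hN
  have hdeg := Polynomial.natDegree_X_pow_sub_C (n := N) (r := f)
  refine Polynomial.IsEisensteinAt.irreducible (𝓟 := Ideal.span {f}) ⟨?_, ?_, ?_⟩
    ((Ideal.span_singleton_prime hf.ne_zero).2 hf) hmonic.isPrimitive (by omega)
  · rw [hmonic.leadingCoeff, Ideal.mem_span_singleton]
    exact fun h => hf.not_isUnit (isUnit_of_dvd_one h)
  · intro n hn
    rw [hdeg] at hn
    rw [Polynomial.coeff_sub, Polynomial.coeff_X_pow, if_neg hn.ne, zero_sub, neg_mem_iff,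
      Polynomial.coeff_C, Ideal.mem_span_singleton]
    split_ifs <;> simp
  · rw [Polynomial.coeff_sub, Polynomial.coeff_X_pow, if_neg hN.symm, zero_sub, neg_mem_iff,
      Polynomial.coeff_C_zero, Ideal.span_singleton_pow, Ideal.mem_span_singleton]
    rintro ⟨c, hc⟩
    apply hf.not_isUnit
    refine IsUnit.of_mul_eq_one c (mul_left_cancel₀ hf.ne_zero ?_)
    linear_combination -hc

theorem prime_T_mul_C_sub_one [IsDomain A] [UniqueFactorizationMonoid A] {f : A} (hf : Prime f)
    {ℓ : ℤ} (hℓ : 1 ≤ ℓ) : (Ideal.span {(T ℓ * C f - 1 : A[T;T⁻¹])}).IsPrime := by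
  obtain ⟨N, rfl⟩ := Int.eq_ofNat_of_zero_le (by omega : 0 ≤ ℓ)
  have hN : N ≠ 0 := by omega
  set q : Polynomial A := Polynomial.X ^ N - Polynomial.C f with hq
  have hprime : Prime q := (irreducible_X_pow_sub_C_of_prime hf hN).prime
  have hI : (Ideal.span {q}).IsPrime := (Ideal.span_singleton_prime hprime.ne_zero).2 hprime
  have hmap : (Ideal.map (algebraMap (Polynomial A) A[T;T⁻¹]) (Ideal.span {q})).IsPrime := by
    refine IsLocalization.isPrime_of_isPrime_disjoint (Submonoid.powers Polynomial.X) _ _ hI ?_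
    rw [Set.disjoint_left]
    rintro _ ⟨i, rfl⟩ hi
    have h := hprime.associated_of_dvd Polynomial.prime_X
      (Ideal.mem_span_singleton.1 (hI.mem_of_pow_mem i hi))
    have h0 := Polynomial.X_dvd_iff.1 h.symm.dvd
    exact hf.ne_zero (by simpa [hq, hN.symm] using h0)
  rw [Ideal.map_span, Set.image_singleton] at hmap
  have hinv := Ideal.map_isPrime_of_equiv (LaurentPolynomial.invert (R := A))
    (I := Ideal.span {algebraMap (Polynomial A) A[T;T⁻¹] q})
  rw [Ideal.map_span, Set.image_singleton] at hinv
  convert hinv using 1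
  rw [Ideal.span_singleton_eq_span_singleton]
  refine ⟨-(LaurentPolynomial.unitT A ^ (-(N : ℤ))), ?_⟩
  have hT : (T N : A[T;T⁻¹]) * T (-N) = 1 := by rw [← T_add]; simp
  have hq' : (LaurentPolynomial.invert (R := A)) (algebraMap (Polynomial A) A[T;T⁻¹] q) =
      T (-N) - C f := by
    rw [algebraMap_eq_toLaurent, hq, map_sub, map_sub, Polynomial.toLaurent_X_pow,
      Polynomial.toLaurent_C, invert_T, invert_C]
  rw [Units.val_neg, LaurentPolynomial.unitT_zpow]
  refine Eq.trans ?_ hq'.symm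
  linear_combination (-C f) * hT

end Domain

theorem isDomain [IsDomain A] [UniqueFactorizationMonoid A] {f : A} (hf : Prime f)
    {ℓ : ℤ} (hℓ : 1 ≤ ℓ) : IsDomain (HypersurfaceRing f ℓ) :=
  (Ideal.Quotient.isDomain_iff_prime _).2 (prime_T_mul_C_sub_one hf hℓ)

theorem algebraMap_injective [IsDomain A] {f : A} (hf : f ≠ 0) {ℓ : ℤ} (hℓ : 1 ≤ ℓ) :
    Function.Injective (algebraMap A (HypersurfaceRing f ℓ)) := by
  let Ω := AlgebraicClosure (FractionRing A)
  have hinj : Function.Injective (algebraMap A Ω) := by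
    rw [IsScalarTower.algebraMap_eq A (FractionRing A) Ω]
    exact (algebraMap (FractionRing A) Ω).injective.comp (IsFractionRing.injective A _)
  have hf' : algebraMap A Ω f ≠ 0 := (map_ne_zero_iff _ hinj).2 hf
  obtain ⟨N, rfl⟩ := Int.eq_ofNat_of_zero_le (by omega : 0 ≤ ℓ)
  have hN : 0 < N := by omega
  obtain ⟨z, hz⟩ := IsAlgClosed.exists_pow_nat_eq (algebraMap A Ω f) hN
  have hz0 : z ≠ 0 := by
    rintro rfl
    rw [zero_pow hN.ne'] at hz
    exact hf' hz.symm
  have h := lift_algebraMap f N (Algebra.ofId A Ω) (Units.mk0 z hz0)⁻¹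
    (by simp [Algebra.ofId_apply, ← hz, hz0])
  intro a b hab
  apply hinj
  have := h a
  rw [hab, h b] at this
  exact this.symm

section Weight

variable (𝒜 : ℤ → Submodule k A) [GradedAlgebra 𝒜]

include 𝒜 in
@[elab_as_elim]
theorem induction_on_homogeneous {f : A} {ℓ : ℤ} {motive : HypersurfaceRing f ℓ → Prop}
    (r : HypersurfaceRing f ℓ) (zero : motive 0)
    (monomial : ∀ (d : ℤ), ∀ a ∈ 𝒜 d, ∀ n : ℤ,
      motive (algebraMap A (HypersurfaceRing f ℓ) a *
        ((unitT f ℓ ^ n : (HypersurfaceRing f ℓ)ˣ))))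
    (add : ∀ r s, motive r → motive s → motive (r + s)) : motive r := by
  induction r using induction_on with
  | add r s hr hs => exact add r s hr hs
  | monomial a n =>
    induction a using DirectSum.Decomposition.inductionOn 𝒜 with
    | zero => simpa using zero
    | homogeneous a => exact monomial _ _ a.2 n
    | add a b ha hb =>
      rw [map_add, add_mul]
      exact add _ _ ha hb

variable {𝒜} {f : A} {m : ℤ} (hf : f ∈ 𝒜 m) (ℓ : ℤ)

/-- The coaction `R_{f,ℓ} → R_{f,ℓ}[T,T⁻¹]` of the grading in which `a` homogeneous of degree `d`
has weight `ℓ d` and the class of `T` has weight `-m`. -/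
noncomputable def coaction : HypersurfaceRing f ℓ →ₐ[k] (HypersurfaceRing f ℓ)[T;T⁻¹] :=
  lift f ℓ
    (gradedTwist 𝒜 (IsScalarTower.toAlgHom k A (HypersurfaceRing f ℓ)[T;T⁻¹])
      (LaurentPolynomial.unitT _ ^ ℓ))
    (Units.map C.toMonoidHom (unitT f ℓ) * LaurentPolynomial.unitT _ ^ (-m))
    (by
      have h := congrArg (C : _ →+* (HypersurfaceRing f ℓ)[T;T⁻¹])
        (unitT_zpow_mul_algebraMap f ℓ)
      have h' : (C (algebraMap A (HypersurfaceRing f ℓ) f) : (HypersurfaceRing f ℓ)[T;T⁻¹]) =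
        IsScalarTower.toAlgHom k A (HypersurfaceRing f ℓ)[T;T⁻¹] f := rfl
      have h'' : C ((unitT f ℓ ^ ℓ : (HypersurfaceRing f ℓ)ˣ) : HypersurfaceRing f ℓ) =
          (((Units.map C.toMonoidHom (unitT f ℓ)) ^ ℓ : ((HypersurfaceRing f ℓ)[T;T⁻¹])ˣ) :
            (HypersurfaceRing f ℓ)[T;T⁻¹]) := by
        rw [← map_zpow]; rfl
      rw [gradedTwist_of_mem 𝒜 _ _ hf, ← h', mul_zpow, ← zpow_mul, ← zpow_mul, ← mul_assoc,
        ← Units.val_mul, mul_assoc, ← zpow_add, show -m * ℓ + ℓ * m = 0 by ring, zpow_zero,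
        mul_one, ← h'', ← map_mul, unitT_zpow_mul_algebraMap, map_one])

theorem coaction_monomial {d : ℤ} {a : A} (ha : a ∈ 𝒜 d) (n : ℤ) :
    coaction hf ℓ (algebraMap A (HypersurfaceRing f ℓ) a *
        ((unitT f ℓ ^ n : (HypersurfaceRing f ℓ)ˣ))) =
      C (algebraMap A (HypersurfaceRing f ℓ) a * ((unitT f ℓ ^ n : (HypersurfaceRing f ℓ)ˣ))) *
        T (ℓ * d - m * n) := by
  have h : IsScalarTower.toAlgHom k A (HypersurfaceRing f ℓ)[T;T⁻¹] a =
    C (algebraMap A (HypersurfaceRing f ℓ) a) := rfl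
  have h'' : C ((unitT f ℓ ^ n : (HypersurfaceRing f ℓ)ˣ) : HypersurfaceRing f ℓ) =
      (((Units.map C.toMonoidHom (unitT f ℓ)) ^ n : ((HypersurfaceRing f ℓ)[T;T⁻¹])ˣ) :
        (HypersurfaceRing f ℓ)[T;T⁻¹]) := by
    rw [← map_zpow]; rfl
  rw [coaction, map_mul, lift_algebraMap, lift_unitT_zpow, gradedTwist_of_mem 𝒜 _ _ ha, h,
    mul_zpow, ← zpow_mul, ← zpow_mul, Units.val_mul, ← h'', LaurentPolynomial.unitT_zpow,
    LaurentPolynomial.unitT_zpow, map_mul, show ℓ * d - m * n = ℓ * d + -m * n by ring, T_add]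
  ring

theorem eval₂_one_coaction (r : HypersurfaceRing f ℓ) :
    eval₂ (RingHom.id _) 1 (coaction hf ℓ r) = r := by
  induction r using induction_on_homogeneous 𝒜 with
  | zero => simp
  | add r s hr hs => rw [map_add, map_add, hr, hs]
  | monomial d a ha n =>
    rw [coaction_monomial hf ℓ ha]
    simp

theorem exists_coeff_coaction_eq (hcop : IsCoprime ℓ m) (e : ℤ) :
    ∃ i : ℤ, ∀ r : HypersurfaceRing f ℓ, ∃ (a : A) (s : ℤ), (coaction hf ℓ r).coeff e =
      algebraMap A _ a * ((unitT f ℓ ^ (i + ℓ * s) : (HypersurfaceRing f ℓ)ˣ)) := by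
  obtain ⟨x, y, hxy⟩ := hcop
  have shift (i s : ℤ) (a : A) (p : ℕ) :
      algebraMap A (HypersurfaceRing f ℓ) a *
        ((unitT f ℓ ^ (i + ℓ * s) : (HypersurfaceRing f ℓ)ˣ)) =
      algebraMap A (HypersurfaceRing f ℓ) (a * f ^ p) *
        ((unitT f ℓ ^ (i + ℓ * (s + p)) : (HypersurfaceRing f ℓ)ˣ)) := by
    have h := congrArg (· ^ p) (unitT_zpow_mul_algebraMap f ℓ)
    rw [mul_add, ← add_assoc, zpow_add _ _ (ℓ * p), zpow_mul _ _ (p : ℤ), zpow_natCast,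
      Units.val_mul, Units.val_pow_eq_pow_val, map_mul, map_pow]
    simp only [mul_pow, one_pow] at h
    linear_combination -(algebraMap A (HypersurfaceRing f ℓ) a) *
        ((unitT f ℓ ^ (i + ℓ * s) : (HypersurfaceRing f ℓ)ˣ)) * h
  refine ⟨-(y * e), fun r => ?_⟩
  induction r using induction_on_homogeneous 𝒜 with
  | zero => exact ⟨0, 0, by simp⟩
  | add r s hr hs =>
    obtain ⟨a, s, ha⟩ := hr
    obtain ⟨b, t, hb⟩ := hs
    rcases le_total s t with hst | hst
    · obtain ⟨p, rfl⟩ := Int.le.dest hst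
      refine ⟨a * f ^ p + b, s + p, ?_⟩
      rw [map_add, AddMonoidAlgebra.coeff_add, Finsupp.add_apply, ha, hb, shift _ _ _ p, map_add,
        add_mul]
    · obtain ⟨p, rfl⟩ := Int.le.dest hst
      refine ⟨a + b * f ^ p, t + p, ?_⟩
      rw [map_add, AddMonoidAlgebra.coeff_add, Finsupp.add_apply, ha, hb, shift _ t _ p, map_add,
        add_mul]
  | monomial d a ha n =>
    rw [coaction_monomial hf ℓ ha, coeff_C_mul_T]
    split_ifs with h
    · have hn : -(y * e) + ℓ * (x * n + y * d) = n := by linear_combination n * hxy + y * h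
      exact ⟨a, x * n + y * d, by rw [hn]⟩
    · exact ⟨0, 0, by simp⟩

include hf in
/-- Every unit of `R_{f,ℓ}` is, up to a constant, a power of the class of `T`. -/
theorem exists_eq_zpow_of_isUnit [IsDomain A] [UniqueFactorizationMonoid A] (hirr : Irreducible f)
    (hunits : ∀ a : A, IsUnit a → ∃ c : k, algebraMap k A c = a) (hℓ : 1 ≤ ℓ)
    (hcop : IsCoprime ℓ m) {u : HypersurfaceRing f ℓ} (hu : IsUnit u) :
    ∃ (c : k) (n : ℤ), u = algebraMap k _ c * ((unitT f ℓ ^ n : (HypersurfaceRing f ℓ)ˣ)) := by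
  have := isDomain hirr.prime hℓ
  have key {v : HypersurfaceRing f ℓ} (hv : IsUnit v) : ∃ (a : A) (n : ℤ),
      v = algebraMap A (HypersurfaceRing f ℓ) a * ((unitT f ℓ ^ n : (HypersurfaceRing f ℓ)ˣ)) := by
    obtain ⟨r, e, hre⟩ := exists_eq_C_mul_T_of_isUnit (hv.map (coaction hf ℓ))
    have hr : r = v := by
      have := eval₂_one_coaction hf ℓ v
      rw [hre] at this
      simpa using this
    obtain ⟨i, hi⟩ := exists_coeff_coaction_eq hf ℓ hcop e
    obtain ⟨a, s, has⟩ := hi v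
    rw [hre, coeff_C_mul_T, if_pos rfl, hr] at has
    exact ⟨a, _, has⟩
  obtain ⟨v, huv⟩ := hu.exists_right_inv
  obtain ⟨a, i, ha⟩ := key hu
  obtain ⟨b, j, hb⟩ := key (IsUnit.of_mul_eq_one_right _ huv)
  have hdvd : ∃ N : ℕ, a ∣ f ^ N := by
    obtain ⟨L, rfl⟩ := Int.eq_ofNat_of_zero_le (by omega : 0 ≤ ℓ)
    have hinj := algebraMap_injective hirr.ne_zero hℓ
    have hab : algebraMap A (HypersurfaceRing f L) (a * b) ^ L *
        ((unitT f L ^ ((L : ℤ) * (i + j)) : (HypersurfaceRing f L)ˣ)) = 1 := by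
      rw [mul_comm (L : ℤ), zpow_mul, zpow_natCast, Units.val_pow_eq_pow_val, ← mul_pow, zpow_add,
        Units.val_mul, map_mul]
      rw [ha, hb] at huv
      have huvL := congrArg (· ^ L) huv
      simp only [one_pow] at huvL
      linear_combination huvL
    have hTf := unitT_zpow_mul_algebraMap f (L : ℤ)
    have hL : L ≠ 0 := by omega
    rcases Int.eq_nat_or_neg (i + j) with ⟨N, hN | hN⟩
    · refine ⟨N, (dvd_mul_right a b).trans ((dvd_pow_self _ hL).trans (dvd_of_eq (hinj ?_)))⟩
      rw [hN, zpow_mul, zpow_natCast, Units.val_pow_eq_pow_val] at hab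
      rw [map_pow, map_pow]
      have h := congrArg (· ^ N) hTf
      simp only [mul_pow, one_pow] at h
      linear_combination (algebraMap A (HypersurfaceRing f L) f ^ N) * hab -
        (algebraMap A (HypersurfaceRing f L) (a * b) ^ L) * h
    · refine ⟨0, (dvd_mul_right a b).trans ((dvd_pow_self _ hL).trans
        ⟨f ^ N, hinj ?_⟩)⟩
      rw [hN, zpow_mul, zpow_neg, zpow_natCast] at hab
      have h := congrArg (· ^ N) hTf
      simp only [mul_pow, one_pow, ← Units.val_pow_eq_pow_val] at h
      rw [pow_zero, map_one, map_mul, map_pow, map_pow, eq_comm]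
      have hinv := (((unitT f (L : ℤ) ^ (L : ℤ)) ^ N)).inv_mul
      linear_combination hab + (algebraMap A (HypersurfaceRing f L) (a * b) ^ L) *
        ((((unitT f (L : ℤ) ^ (L : ℤ)) ^ N)⁻¹ : (HypersurfaceRing f L)ˣ)) * h -
        (algebraMap A (HypersurfaceRing f L) (a * b) ^ L) *
          (algebraMap A (HypersurfaceRing f L) f ^ N) * hinv
  obtain ⟨N, hN⟩ := hdvd
  obtain ⟨p, -, hp⟩ := (dvd_prime_pow hirr.prime _).1 hN
  obtain ⟨w, hw⟩ := hp.symm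
  obtain ⟨c, hc⟩ := hunits w w.isUnit
  refine ⟨c, i - ℓ * p, ?_⟩
  have h := congrArg (· ^ p) (unitT_zpow_mul_algebraMap f ℓ)
  simp only [mul_pow, one_pow, ← Units.val_pow_eq_pow_val] at h
  rw [ha, ← hw, ← hc, map_mul, map_pow, ← IsScalarTower.algebraMap_apply,
    show i = i - ℓ * p + ℓ * p by ring, zpow_add, zpow_mul _ _ (p : ℤ), zpow_natCast,
    Units.val_mul]
  simp only [add_sub_cancel_right]
  linear_combination (algebraMap k (HypersurfaceRing f ℓ) c) *
    ((unitT f ℓ ^ (i - ℓ * p) : (HypersurfaceRing f ℓ)ˣ)) * h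

include hf in
theorem eq_zero_of_zpow_eq_algebraMap [Nontrivial (HypersurfaceRing f ℓ)] (hm : m ≠ 0) {n : ℤ}
    {c : k} (h : ((unitT f ℓ ^ n : (HypersurfaceRing f ℓ)ˣ) : HypersurfaceRing f ℓ) =
      algebraMap k _ c) : n = 0 := by
  have h1 := coaction_monomial hf ℓ (SetLike.GradedOne.one_mem (A := 𝒜)) n
  rw [map_one, one_mul, h, AlgHom.commutes] at h1
  have h2 : algebraMap k (HypersurfaceRing f ℓ)[T;T⁻¹] c = C (algebraMap k _ c) * T 0 := by
    rw [T_zero, mul_one]; rfl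
  rw [h2] at h1
  have h3 := congrArg (fun p : (HypersurfaceRing f ℓ)[T;T⁻¹] => p.coeff 0) h1
  simp only [coeff_C_mul_T, if_true] at h3
  split_ifs at h3 with h4
  · simpa [hm] using h4
  · exact absurd (h.trans h3) (Units.ne_zero _)

end Weight

end HypersurfaceRing
end Hypersurface

section GenericFiber

variable {n : ℕ} {f : MvPolynomial (Fin n) ℂ} {m : ℤ}

/-- The structure map from `ℂ[x₁,…,xₙ]` to the coordinate ring of the generic fiber. -/
noncomputable def genericFiberCoeff (n : ℕ) (f : MvPolynomial (Fin n) ℂ) (j : ℤ) :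
    MvPolynomial (Fin n) ℂ →ₐ[ℂ] genericFiberRing n f j :=
  (Ideal.Quotient.mkₐ ℂ _).comp
    { MvPolynomial.map (algebraMap ℂ (RatFunc ℂ)) with
      commutes' := fun c => by
        change MvPolynomial.map (algebraMap ℂ (RatFunc ℂ)) (MvPolynomial.C c) = _
        rw [MvPolynomial.map_C]
        rfl }

/-- The indeterminate of `ℂ(t)` as a unit. -/
noncomputable def ratFuncUnitX : (RatFunc ℂ)ˣ := Units.mk0 RatFunc.X RatFunc.X_ne_zero

theorem genericFiber_relation (j : ℤ) :
    algebraMap (RatFunc ℂ) (genericFiberRing n f j) (RatFunc.X ^ j) *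
      genericFiberCoeff n f j f = 1 := by
  change Ideal.Quotient.mk _ (MvPolynomial.C (RatFunc.X ^ j)) * Ideal.Quotient.mk _
    (MvPolynomial.map (algebraMap ℂ (RatFunc ℂ)) f) = 1
  rw [← map_mul, ← sub_eq_zero, ← map_one (Ideal.Quotient.mk _), ← map_sub,
    Ideal.Quotient.eq_zero_iff_mem]
  exact Ideal.mem_span_singleton_self _

theorem genericFiber_algHom_ext {B : Type*} [CommRing B] [Algebra (RatFunc ℂ) B] {j : ℤ}
    {g h : genericFiberRing n f j →ₐ[RatFunc ℂ] B}
    (hgh : ∀ a, g (genericFiberCoeff n f j a) = h (genericFiberCoeff n f j a)) : g = h := by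
  apply Ideal.Quotient.algHom_ext
  apply MvPolynomial.algHom_ext
  intro i
  have := hgh (MvPolynomial.X i)
  have hX : genericFiberCoeff n f j (MvPolynomial.X i) =
      Ideal.Quotient.mk _ (MvPolynomial.X i) :=
    congrArg (Ideal.Quotient.mk _) (MvPolynomial.map_X _ i)
  rw [hX] at this
  exact this

theorem exists_genericFiber_lift {B : Type*} [CommRing B] [Algebra ℂ B] [Algebra (RatFunc ℂ) B]
    [IsScalarTower ℂ (RatFunc ℂ) B] (j : ℤ) (g : MvPolynomial (Fin n) ℂ →ₐ[ℂ] B)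
    (hg : algebraMap (RatFunc ℂ) B (RatFunc.X ^ j) * g f = 1) :
    ∃ h : genericFiberRing n f j →ₐ[RatFunc ℂ] B, ∀ a, h (genericFiberCoeff n f j a) = g a := by
  let e : MvPolynomial (Fin n) (RatFunc ℂ) →ₐ[RatFunc ℂ] B :=
    MvPolynomial.aeval fun i => g (MvPolynomial.X i)
  have he (a) : e (MvPolynomial.map (algebraMap ℂ (RatFunc ℂ)) a) = g a := by
    rw [MvPolynomial.aeval_map_algebraMap]
    exact (DFunLike.congr_fun (MvPolynomial.aeval_unique g) a).symm
  refine ⟨Ideal.Quotient.liftₐ _ e fun a ha => ?_, he⟩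
  have hle : Ideal.span {MvPolynomial.C ((RatFunc.X : RatFunc ℂ) ^ j) *
      MvPolynomial.map (algebraMap ℂ (RatFunc ℂ)) f - 1} ≤ RingHom.ker e := by
    rw [Ideal.span_singleton_le_iff_mem, RingHom.mem_ker, map_sub, map_mul, he, map_one,
      sub_eq_zero, ← hg]
    congr 1
    exact e.commutes _
  exact hle ha

/-- `Y_j` is the generic fiber of `c T ^ ε : Spec R_{f,ℓ} → 𝔸¹_*` when `ε = ±1` and
`j ≡ ε ℓ` modulo `m`: it is the universal `ℂ(t)`-algebra under `R_{f,ℓ}` in which `c T ^ ε`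
becomes `t`. -/
theorem exists_hypersurfaceRing_hom_genericFiber
    (𝒜 : ℤ → Submodule ℂ (MvPolynomial (Fin n) ℂ)) [GradedAlgebra 𝒜] (hm : 1 ≤ m)
    (hf : f ∈ 𝒜 m) {ℓ j ε : ℤ} (hε : ε * ε = 1) (hj : j ≡ ε * ℓ [ZMOD m]) {c : ℂ} (hc : c ≠ 0) :
    ∃ κ : HypersurfaceRing f ℓ →ₐ[ℂ] genericFiberRing n f j,
      κ (algebraMap ℂ _ c * ((HypersurfaceRing.unitT f ℓ ^ ε : (HypersurfaceRing f ℓ)ˣ))) =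
        algebraMap (RatFunc ℂ) _ RatFunc.X ∧
      (∀ (B : Type) [CommRing B] [Algebra ℂ B] [Algebra (RatFunc ℂ) B]
        [IsScalarTower ℂ (RatFunc ℂ) B] (g : HypersurfaceRing f ℓ →ₐ[ℂ] B),
        g (algebraMap ℂ _ c * ((HypersurfaceRing.unitT f ℓ ^ ε : (HypersurfaceRing f ℓ)ˣ))) =
          algebraMap (RatFunc ℂ) _ RatFunc.X →
        ∃ h : genericFiberRing n f j →ₐ[RatFunc ℂ] B, ∀ r, h (κ r) = g r) ∧
      ∀ (B : Type) [CommRing B] [Algebra (RatFunc ℂ) B]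
        (h h' : genericFiberRing n f j →ₐ[RatFunc ℂ] B), (∀ r, h (κ r) = h' (κ r)) → h = h' := by
  obtain ⟨q, hq⟩ := hj.dvd
  obtain ⟨M, rfl⟩ := Int.eq_ofNat_of_zero_le (by omega : 0 ≤ m)
  obtain ⟨μ, hμ⟩ := IsAlgClosed.exists_pow_nat_eq (c ^ (ε * ℓ)) (by omega : 0 < M)
  have hμ0 : μ ≠ 0 := by
    rintro rfl
    rw [zero_pow (by omega)] at hμ
    exact zpow_ne_zero _ hc hμ.symm
  let γ : (RatFunc ℂ)ˣ := Units.map (algebraMap ℂ (RatFunc ℂ)).toMonoidHom (Units.mk0 c hc)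
  let ν : (RatFunc ℂ)ˣ := Units.map (algebraMap ℂ (RatFunc ℂ)).toMonoidHom (Units.mk0 μ hμ0)
  have hνγ : ν ^ (M : ℤ) = γ ^ (ε * ℓ) := by
    rw [zpow_natCast, ← map_pow, ← map_zpow]
    congr 1
    ext
    simpa using hμ
  let w : (RatFunc ℂ)ˣ := (γ⁻¹ * ratFuncUnitX) ^ ε
  let s : (RatFunc ℂ)ˣ := ν * ratFuncUnitX ^ (-q)
  have hws : w ^ ℓ * s ^ (M : ℤ) = ratFuncUnitX ^ j := by
    rw [mul_zpow, hνγ, ← zpow_mul, ← zpow_mul, mul_zpow, inv_zpow,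
      show j = ε * ℓ + -q * M by linear_combination -hq, zpow_add]
    rw [mul_mul_mul_comm, inv_mul_cancel, one_mul]
  have hγw : γ * w ^ ε = ratFuncUnitX := by
    rw [← zpow_mul, hε, zpow_one, mul_inv_cancel_left]
  have hval (B : Type) [CommRing B] [Algebra (RatFunc ℂ) B] (i : ℤ) :
      algebraMap (RatFunc ℂ) B (RatFunc.X ^ i) =
        (Units.map (algebraMap (RatFunc ℂ) B).toMonoidHom (ratFuncUnitX ^ i) : Bˣ) := by
    change _ = algebraMap _ B ((ratFuncUnitX ^ i : (RatFunc ℂ)ˣ) : RatFunc ℂ)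
    rw [Units.val_zpow_eq_zpow_val]
    rfl
  let σ (B : Type) [CommRing B] [Algebra (RatFunc ℂ) B] : (RatFunc ℂ)ˣ →* Bˣ :=
    Units.map (algebraMap (RatFunc ℂ) B).toMonoidHom
  have hγval (B : Type) [CommRing B] [Algebra ℂ B] [Algebra (RatFunc ℂ) B]
      [IsScalarTower ℂ (RatFunc ℂ) B] : algebraMap ℂ B c = σ B γ :=
    IsScalarTower.algebraMap_apply ℂ (RatFunc ℂ) B c
  have hXval (B : Type) [CommRing B] [Algebra (RatFunc ℂ) B] :
      algebraMap (RatFunc ℂ) B RatFunc.X = σ B ratFuncUnitX := rfl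
  let tw := gradedTwist 𝒜 (genericFiberCoeff n f j) (σ _ s)
  have htw : (((σ (genericFiberRing n f j) w) ^ ℓ : (genericFiberRing n f j)ˣ) :
      genericFiberRing n f j) * tw f = 1 := by
    rw [gradedTwist_of_mem 𝒜 _ _ hf, ← mul_assoc, ← Units.val_mul, ← map_zpow, ← map_zpow,
      ← map_mul, hws, ← hval, genericFiber_relation]
  refine ⟨HypersurfaceRing.lift f ℓ tw (σ _ w) htw, ?_, ?_, ?_⟩
  · rw [map_mul, HypersurfaceRing.lift_unitT_zpow, AlgHom.commutes, hγval, ← map_zpow,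
      ← Units.val_mul, ← map_mul, hγw]
    rfl
  · intro B _ _ _ _ g hg
    set v : Bˣ := Units.map (g : HypersurfaceRing f ℓ →* B) (HypersurfaceRing.unitT f ℓ) with hv
    have hvval (i : ℤ) : g ((HypersurfaceRing.unitT f ℓ ^ i : (HypersurfaceRing f ℓ)ˣ)) =
        ((v ^ i : Bˣ) : B) := by
      rw [hv, ← map_zpow]; rfl
    have hvw : v = σ B w := by
      have h1 : σ B γ * v ^ ε = σ B ratFuncUnitX := by
        ext
        rw [Units.val_mul, ← hγval, ← hXval, ← hg, map_mul, AlgHom.commutes, hvval]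
      rw [← hγw, map_mul, mul_right_inj, map_zpow] at h1
      have h2 := congrArg (· ^ ε) h1
      simpa only [← zpow_mul, hε, zpow_one] using h2
    let g₀ := g.comp (IsScalarTower.toAlgHom ℂ (MvPolynomial (Fin n) ℂ) (HypersurfaceRing f ℓ))
    have hg₀ (a) : g₀ a = g (algebraMap _ _ a) := rfl
    have hrel := congrArg g (HypersurfaceRing.unitT_zpow_mul_algebraMap f ℓ)
    rw [map_mul, map_one, hvval, hvw, ← hg₀] at hrel
    obtain ⟨h, hh⟩ := exists_genericFiber_lift (f := f) j (gradedTwist 𝒜 g₀ (σ B s⁻¹)) (by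
      rw [gradedTwist_of_mem 𝒜 _ _ hf, hval, ← hws, ← mul_assoc, ← map_zpow, ← Units.val_mul]
      change ((σ B (w ^ ℓ * s ^ (M : ℤ)) * σ B (s⁻¹ ^ (M : ℤ)) : Bˣ) : B) * g₀ f = 1
      rw [← map_mul, mul_assoc, inv_zpow, mul_inv_cancel, mul_one, map_zpow, hrel])
    refine ⟨h, fun r => ?_⟩
    have hcomp : (h.restrictScalars ℂ).comp (HypersurfaceRing.lift f ℓ tw (σ _ w) htw) = g := by
      have hσ (i : ℤ) : h ((σ (genericFiberRing n f j) (s ^ i) :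
          (genericFiberRing n f j)ˣ) : genericFiberRing n f j) = σ B (s ^ i) :=
        h.commutes _
      apply HypersurfaceRing.algHom_ext'
      · have hA : ((h.restrictScalars ℂ).comp tw) = g₀ := by
          apply algHom_ext_of_homogeneous 𝒜
          intro d a ha
          change h (tw a) = g₀ a
          rw [gradedTwist_of_mem 𝒜 _ _ ha, map_mul, hh, gradedTwist_of_mem 𝒜 _ _ ha,
            ← map_zpow, hσ, ← map_zpow, ← mul_assoc, ← Units.val_mul, ← map_mul, inv_zpow,
            mul_inv_cancel, map_one, Units.val_one, one_mul]
        intro a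
        rw [AlgHom.comp_apply, HypersurfaceRing.lift_algebraMap]
        exact DFunLike.congr_fun hA a
      · have h1 := HypersurfaceRing.lift_unitT_zpow f ℓ tw (σ _ w) htw 1
        rw [zpow_one, zpow_one] at h1
        have h2 := hvval 1
        rw [zpow_one, zpow_one, hvw] at h2
        rw [AlgHom.comp_apply, h1, h2]
        exact h.commutes _
    exact DFunLike.congr_fun hcomp r
  · intro B _ _ h h' hhh'
    let : Algebra ℂ B := ((algebraMap (RatFunc ℂ) B).comp (algebraMap ℂ (RatFunc ℂ))).toAlgebra
    have : IsScalarTower ℂ (RatFunc ℂ) B := IsScalarTower.of_algebraMap_eq fun _ => rfl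
    apply genericFiber_algHom_ext
    have hA : (h.restrictScalars ℂ).comp (genericFiberCoeff n f j) =
        (h'.restrictScalars ℂ).comp (genericFiberCoeff n f j) := by
      apply algHom_ext_of_homogeneous 𝒜
      intro d a ha
      have h1 := hhh' (algebraMap _ _ a)
      rw [HypersurfaceRing.lift_algebraMap, gradedTwist_of_mem 𝒜 _ _ ha,
        ← map_zpow (σ (genericFiberRing n f j)), map_mul h, map_mul h'] at h1
      have h2 : h (σ (genericFiberRing n f j) (s ^ d) : (genericFiberRing n f j)ˣ) =
        σ B (s ^ d) := h.commutes _
      have h3 : h' (σ (genericFiberRing n f j) (s ^ d) : (genericFiberRing n f j)ˣ) =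
        σ B (s ^ d) := h'.commutes _
      rw [h2, h3] at h1
      exact (Units.mul_right_inj _).1 h1
    exact DFunLike.congr_fun hA

/-- Two algebras over `L` with the universal property of a base change of `R`, respectively `R'`,
along `L ← k[τ]` are isomorphic as soon as `R` and `R'` are isomorphic compatibly with the
parameters `τ` and `τ'`. -/
theorem nonempty_algEquiv_of_universal {k L R R' Y Y' : Type} [CommRing k] [CommRing L]
    [Algebra k L] [CommRing R] [CommRing R'] [CommRing Y] [CommRing Y'] [Algebra k R]
    [Algebra k R'] [Algebra k Y] [Algebra k Y'] [Algebra L Y] [Algebra L Y']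
    [IsScalarTower k L Y] [IsScalarTower k L Y'] {τ : R} {τ' : R'} {t : L}
    {κ : R →ₐ[k] Y} {κ' : R' →ₐ[k] Y'} (hκ : κ τ = algebraMap L Y t)
    (hκ' : κ' τ' = algebraMap L Y' t)
    (lift : ∀ (B : Type) [CommRing B] [Algebra k B] [Algebra L B] [IsScalarTower k L B]
      (g : R →ₐ[k] B), g τ = algebraMap L _ t → ∃ h : Y →ₐ[L] B, ∀ r, h (κ r) = g r)
    (lift' : ∀ (B : Type) [CommRing B] [Algebra k B] [Algebra L B] [IsScalarTower k L B]
      (g : R' →ₐ[k] B), g τ' = algebraMap L _ t → ∃ h : Y' →ₐ[L] B, ∀ r, h (κ' r) = g r)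
    (ext : ∀ (B : Type) [CommRing B] [Algebra L B] (h h' : Y →ₐ[L] B),
      (∀ r, h (κ r) = h' (κ r)) → h = h')
    (ext' : ∀ (B : Type) [CommRing B] [Algebra L B] (h h' : Y' →ₐ[L] B),
      (∀ r, h (κ' r) = h' (κ' r)) → h = h')
    (Φ : R ≃ₐ[k] R') (hΦ : Φ τ = τ') : Nonempty (Y ≃ₐ[L] Y') := by
  subst hΦ
  obtain ⟨h, hh⟩ := lift _ (κ'.comp Φ.toAlgHom) hκ'
  obtain ⟨h', hh'⟩ := lift' _ (κ.comp Φ.symm.toAlgHom)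
    ((congrArg κ (Φ.symm_apply_apply τ)).trans hκ)
  refine ⟨AlgEquiv.ofAlgHom h h' (ext' _ _ _ fun r => ?_) (ext _ _ _ fun r => ?_)⟩
  · rw [AlgHom.comp_apply, hh']
    exact (hh _).trans (congrArg κ' (Φ.apply_symm_apply r))
  · rw [AlgHom.comp_apply, hh]
    exact (hh' _).trans (congrArg κ (Φ.symm_apply_apply r))

theorem genericFiberRing_equiv_of_hypersurfaceRing_equiv
    (𝒜 : ℤ → Submodule ℂ (MvPolynomial (Fin n) ℂ)) [GradedAlgebra 𝒜] (hm : 1 ≤ m)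
    (hf : f ∈ 𝒜 m) {ℓ ℓ' j ε : ℤ} (Φ : HypersurfaceRing f ℓ ≃ₐ[ℂ] HypersurfaceRing f ℓ') {c : ℂ}
    (hc : c ≠ 0) (hε : ε * ε = 1) (hΦ : Φ (HypersurfaceRing.unitT f ℓ) =
      algebraMap ℂ _ c * ((HypersurfaceRing.unitT f ℓ' ^ ε : (HypersurfaceRing f ℓ')ˣ)))
    (hj : j ≡ ε * ℓ' [ZMOD m]) :
    Nonempty ((genericFiberRing n f ℓ) ≃ₐ[RatFunc ℂ] (genericFiberRing n f j)) := by
  obtain ⟨κ, hκ, hlift, hext⟩ := exists_hypersurfaceRing_hom_genericFiber 𝒜 hm hf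
    (ℓ := ℓ) (j := ℓ) (ε := 1) (by norm_num) (by rw [one_mul]) one_ne_zero
  obtain ⟨κ', hκ', hlift', hext'⟩ := exists_hypersurfaceRing_hom_genericFiber 𝒜 hm hf hε hj hc
  refine nonempty_algEquiv_of_universal hκ hκ' hlift hlift' hext hext' Φ ?_
  rw [map_one, one_mul, zpow_one, hΦ]

end GenericFiber

theorem algEquiv_zpow_eq {k R R' : Type*} [Field k] [CommRing R] [CommRing R'] [Algebra k R]
    [Algebra k R'] (Φ : R ≃ₐ[k] R') {u : Rˣ} {u' : R'ˣ} {c : k} (hc : c ≠ 0) {ε : ℤ}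
    (hΦ : Φ u = algebraMap k R' c * ((u' ^ ε : R'ˣ) : R')) (i : ℤ) :
    Φ ((u ^ i : Rˣ) : R) = algebraMap k R' (c ^ i) * ((u' ^ (ε * i) : R'ˣ) : R') := by
  have h : Units.map (Φ : R →* R') u =
      Units.map (algebraMap k R').toMonoidHom (Units.mk0 c hc) * u' ^ ε := Units.ext hΦ
  have h' := congrArg (fun v : R'ˣ => ((v ^ i : R'ˣ) : R')) h
  simp only [mul_zpow, ← map_zpow, ← zpow_mul, Units.val_mul] at h'
  refine Eq.trans h' (congrArg (· * _) ?_)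
  change algebraMap k R' ((Units.mk0 c hc ^ i : kˣ) : k) = _
  rw [Units.val_zpow_eq_zpow_val, Units.val_mk0]

/-- **Proposition (generic fibers).** Let `A = ℂ[x₁,…,xₙ]` with a `ℤ`-grading, and let
`f ∈ A` be irreducible and homogeneous of degree `m ≥ 1`.  Let `ℓ, ℓ' ≥ 1` be coprime
with `m` and let `ℓ'' ≥ 1` be congruent to `-ℓ'` modulo `m`.  If
`R_{f,ℓ} = A[T,T⁻¹]/(T^ℓ f - 1)` and `R_{f,ℓ'}` are isomorphic `ℂ`-algebras, then over
`K = ℂ(t)` the generic fiber `Y_ℓ` is `K`-isomorphic to `Y_ℓ'` or to `Y_ℓ''`. -/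
theorem generic_fiber_iso_of_hypersurface_iso (n : ℕ) (hn : 1 ≤ n)
    (𝒜 : ℤ → Submodule ℂ (MvPolynomial (Fin n) ℂ)) [GradedAlgebra 𝒜]
    (m : ℤ) (hm : 1 ≤ m)
    (f : MvPolynomial (Fin n) ℂ) (hf : f ∈ 𝒜 m) (hirr : Irreducible f)
    (ℓ ℓ' ℓ'' : ℤ) (hℓ : 1 ≤ ℓ) (hℓ' : 1 ≤ ℓ') (hℓ'' : 1 ≤ ℓ'')
    (hcopℓ : Int.gcd ℓ m = 1) (hcopℓ' : Int.gcd ℓ' m = 1)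
    (hcong : ℓ'' ≡ -ℓ' [ZMOD m])
    (hiso : Nonempty ((LaurentPolynomial (MvPolynomial (Fin n) ℂ) ⧸
        Ideal.span {T ℓ * C f - 1}) ≃ₐ[ℂ]
      (LaurentPolynomial (MvPolynomial (Fin n) ℂ) ⧸
        Ideal.span {T ℓ' * C f - 1}))) :
    Nonempty ((genericFiberRing n f ℓ) ≃ₐ[RatFunc ℂ] (genericFiberRing n f ℓ')) ∨
    Nonempty ((genericFiberRing n f ℓ) ≃ₐ[RatFunc ℂ] (genericFiberRing n f ℓ'')) := by
  obtain ⟨Φ⟩ := hiso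
  change HypersurfaceRing f ℓ ≃ₐ[ℂ] HypersurfaceRing f ℓ' at Φ
  have hunits (a : MvPolynomial (Fin n) ℂ) (ha : IsUnit a) :
      ∃ c : ℂ, algebraMap ℂ _ c = a := by
    obtain ⟨c, -, hc⟩ := MvPolynomial.isUnit_iff_eq_C_of_isReduced.1 ha
    exact ⟨c, hc.symm⟩
  have := HypersurfaceRing.isDomain hirr.prime hℓ'
  obtain ⟨c, ε, hΦ⟩ := HypersurfaceRing.exists_eq_zpow_of_isUnit hf ℓ' hirr hunits hℓ'
    (Int.isCoprime_iff_gcd_eq_one.2 hcopℓ') ((HypersurfaceRing.unitT f ℓ).isUnit.map Φ)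
  obtain ⟨b, δ, hΨ⟩ := HypersurfaceRing.exists_eq_zpow_of_isUnit hf ℓ hirr hunits hℓ
    (Int.isCoprime_iff_gcd_eq_one.2 hcopℓ) ((HypersurfaceRing.unitT f ℓ').isUnit.map Φ.symm)
  have hc : c ≠ 0 := by
    rintro rfl
    rw [map_zero, zero_mul] at hΦ
    exact ((HypersurfaceRing.unitT f ℓ).isUnit.map Φ).ne_zero hΦ
  have hεδ : ε * δ = 1 := by
    have h4 := congrArg Φ hΨ
    rw [AlgEquiv.apply_symm_apply, map_mul, AlgEquiv.commutes,
      algEquiv_zpow_eq Φ hc hΦ, ← mul_assoc, ← map_mul] at h4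
    have h5 : ((HypersurfaceRing.unitT f ℓ' ^ (1 - ε * δ) : (HypersurfaceRing f ℓ')ˣ) :
        HypersurfaceRing f ℓ') = algebraMap ℂ _ (b * c ^ δ) := by
      rw [zpow_sub, zpow_one, Units.val_mul, h4, mul_assoc, ← Units.val_mul, mul_inv_cancel,
        Units.val_one, mul_one]
    have := HypersurfaceRing.eq_zero_of_zpow_eq_algebraMap hf ℓ' (by omega) h5
    omega
  have hε : ε = 1 ∨ ε = -1 := Int.isUnit_iff.1 (IsUnit.of_mul_eq_one _ hεδ)
  have key (j : ℤ) (hj : j ≡ ε * ℓ' [ZMOD m]) :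
      Nonempty ((genericFiberRing n f ℓ) ≃ₐ[RatFunc ℂ] (genericFiberRing n f j)) := by
    refine genericFiberRing_equiv_of_hypersurfaceRing_equiv 𝒜 hm hf Φ hc ?_ hΦ hj
    rcases hε with rfl | rfl <;> norm_num
  rcases hε with rfl | rfl
  · exact Or.inl (key ℓ' (by rw [one_mul]))
  · exact Or.inr (key ℓ'' (by rwa [neg_one_mul]))
end

section
/- For ℓ ∈ {1,2,3} let B_ℓ = ℂ[x,y,t]/(t^ℓ(x² + y³) − 1). Then for all distinct ℓ, ℓ' ∈ {1,2,3} and every integer n ≥ 0, the ℂ-algebras B_ℓ ⊗_ℂ Lₙ and B_{ℓ'} ⊗_ℂ Lₙ are not isomorphic, where Lₙ denotes the Laurent polynomial ring in n variables over ℂ (the group algebra of ℤⁿ over ℂ). -/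
open TensorProduct

/-- `B_ℓ = ℂ[x,y,t]/(t^ℓ(x² + y³) - 1)`, the coordinate ring of the surface
`X̃_{f,ℓ} ⊂ 𝔸³` for `f = x² + y³`. -/
noncomputable abbrev surfaceRing23 (ℓ : ℕ) : Type :=
  MvPolynomial (Fin 3) ℂ ⧸ Ideal.span
    {(MvPolynomial.X 2 : MvPolynomial (Fin 3) ℂ) ^ ℓ *
      ((MvPolynomial.X 0) ^ 2 + (MvPolynomial.X 1) ^ 3) - 1}

/-- `Lₙ = ℂ[u₁^{±1},…,uₙ^{±1}]`, the Laurent polynomial ring in `n` variables,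
i.e. the group algebra of `ℤⁿ` over `ℂ`. -/
noncomputable abbrev laurentRing (n : ℕ) : Type :=
  AddMonoidAlgebra ℂ (Fin n →₀ ℤ)


open Polynomial

namespace WeierstrassCurve.Affine.CoordinateRing

variable {R : Type*} [CommRing R] {W : Affine R}

/-- The Mordell curve `Y² = X³ + a`. -/
abbrev mordell (a : R) : Affine R := ⟨0, 0, 0, 0, a⟩

lemma mordell_equation (a : R) :
    (mk (mordell a) X) ^ 2 = ((X : R[X]) • (1 : (mordell a).CoordinateRing)) ^ 3 +
      algebraMap R _ a := by
  rw [← sub_eq_zero, smul, mul_one, IsScalarTower.algebraMap_apply R R[X]]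
  change mk (mordell a) X ^ 2 - (mk (mordell a) (C X) ^ 3 + mk (mordell a) (C (C a))) = 0
  rw [← map_pow, ← map_pow, ← map_add, ← map_sub]
  refine AdjoinRoot.mk_eq_zero.mpr ⟨1, ?_⟩
  simp [polynomial]

/-- A ring homomorphism out of a coordinate ring, evaluated in the basis `1, Y`. -/
lemma map_smul_basis {S : Type*} [CommRing S] (φ : W.CoordinateRing →+* S) (p q : R[X]) :
    φ (p • 1 + q • mk W X) =
      p.eval₂ (φ.comp (algebraMap R _)) (φ ((X : R[X]) • 1)) +
        q.eval₂ (φ.comp (algebraMap R _)) (φ ((X : R[X]) • 1)) * φ (mk W X) := by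
  have key (p : R[X]) : φ (algebraMap R[X] _ p) =
      p.eval₂ (φ.comp (algebraMap R _)) (φ ((X : R[X]) • 1)) := by
    rw [← RingHom.comp_apply, ← eval₂_C_X (p := p), hom_eval₂, eval₂_C_X]
    congr 1
    rw [Algebra.smul_def, mul_one, RingHom.comp_apply]
  rw [map_add, Algebra.smul_def, Algebra.smul_def, mul_one, map_mul, key, key]

section UniversalProperty

variable {S T : Type*} [CommRing S] [Algebra S R] [CommRing T] [Algebra S T]

/-- The universal property of the coordinate ring of a Mordell curve. -/
noncomputable def mordellLift {a : R} (g : R →ₐ[S] T) (x y : T) (h : y ^ 2 = x ^ 3 + g a) :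
    (mordell a).CoordinateRing →ₐ[S] T :=
  AdjoinRoot.liftAlgHom _ (aevalTower g x) y (by
    simp only [polynomial]
    simp [h, eval₂_pow])

variable {a : R} (g : R →ₐ[S] T) (x y : T) (h : y ^ 2 = x ^ 3 + g a)

lemma mordellLift_X : mordellLift g x y h ((X : R[X]) • 1) = x := by
  rw [smul, mul_one]
  simp [mordellLift]

lemma mordellLift_Y : mordellLift g x y h (mk _ X) = y := by
  simp [mordellLift]

lemma mordellLift_algebraMap (r : R) : mordellLift g x y h (algebraMap R _ r) = g r := by
  rw [IsScalarTower.algebraMap_apply R R[X]]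
  change mordellLift g x y h (mk _ (C (C r))) = _
  simp [mordellLift]

lemma algHom_ext_of_basis {f f' : W.CoordinateRing →ₐ[S] T}
    (hR : ∀ r : R, f (algebraMap R _ r) = f' (algebraMap R _ r))
    (hX : f ((X : R[X]) • 1) = f' ((X : R[X]) • 1)) (hY : f (mk _ X) = f' (mk _ X)) :
    f = f' := by
  refine AlgHom.ext fun u ↦ ?_
  obtain ⟨p, q, rfl⟩ := exists_smul_basis_eq u
  have hf := map_smul_basis (f : W.CoordinateRing →+* T) p q
  have hf' := map_smul_basis (f' : W.CoordinateRing →+* T) p q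
  have hcomp : (f : W.CoordinateRing →+* T).comp (algebraMap R _) =
      (f' : W.CoordinateRing →+* T).comp (algebraMap R _) := RingHom.ext hR
  simp only [RingHom.coe_coe] at hf hf'
  rw [hf, hf', hX, hY, hcomp]

end UniversalProperty

variable [IsDomain R]

/-- The pole order at infinity of a regular function on an affine Weierstrass curve,
with value `⊥` at `0`. -/
noncomputable def poleOrder (f : W.CoordinateRing) : WithBot ℕ :=
  (Algebra.norm R[X] f).degree

lemma poleOrder_smul_basis (p q : R[X]) :
    poleOrder (p • (1 : W.CoordinateRing) + q • mk W X) =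
      max (2 • p.degree) (2 • q.degree + 3) :=
  degree_norm_smul_basis p q

lemma poleOrder_mul (f g : W.CoordinateRing) : poleOrder (f * g) = poleOrder f + poleOrder g := by
  simp [poleOrder, degree_mul]

lemma poleOrder_zero : poleOrder (0 : W.CoordinateRing) = ⊥ := by
  simpa [nsmul_eq_mul] using poleOrder_smul_basis (W := W) 0 0

lemma poleOrder_pow (f : W.CoordinateRing) (n : ℕ) : poleOrder (f ^ n) = n • poleOrder f := by
  simp [poleOrder, degree_pow]

lemma poleOrder_neg (f : W.CoordinateRing) : poleOrder (-f) = poleOrder f := by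
  obtain ⟨p, q, rfl⟩ := exists_smul_basis_eq f
  rw [neg_add, ← neg_smul, ← neg_smul, poleOrder_smul_basis, poleOrder_smul_basis,
    degree_neg, degree_neg]

lemma poleOrder_add_le (f g : W.CoordinateRing) :
    poleOrder (f + g) ≤ max (poleOrder f) (poleOrder g) := by
  obtain ⟨p, q, rfl⟩ := exists_smul_basis_eq f
  obtain ⟨p', q', rfl⟩ := exists_smul_basis_eq g
  rw [add_add_add_comm, ← add_smul, ← add_smul]
  simp only [poleOrder_smul_basis]
  have hp := degree_add_le p p'
  have hq := degree_add_le q q'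
  rcases le_max_iff.mp hp with hp | hp <;> rcases le_max_iff.mp hq with hq | hq <;>
    refine max_le ((nsmul_le_nsmul_right hp 2).trans ?_)
      ((add_le_add_left (nsmul_le_nsmul_right hq 2) 3).trans ?_) <;> simp

lemma poleOrder_add_eq_of_lt {f g : W.CoordinateRing} (h : poleOrder f < poleOrder g) :
    poleOrder (f + g) = poleOrder g := by
  apply le_antisymm ((poleOrder_add_le f g).trans (max_le h.le le_rfl))
  have key := poleOrder_add_le (f + g) (-f)
  rw [poleOrder_neg, add_neg_cancel_comm] at key
  exact (le_max_iff.mp key).resolve_right h.not_ge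

lemma poleOrder_algebraMap {r : R} (hr : r ≠ 0) :
    poleOrder (algebraMap R W.CoordinateRing r) = 0 := by
  have : algebraMap R W.CoordinateRing r = (C r) • 1 + (0 : R[X]) • mk W X := by
    rw [zero_smul, add_zero, IsScalarTower.algebraMap_apply R R[X], Algebra.smul_def, mul_one]
    rfl
  rw [this, poleOrder_smul_basis, degree_C hr]
  rfl

lemma poleOrder_algebraMap_le (r : R) : poleOrder (algebraMap R W.CoordinateRing r) ≤ 0 := by
  by_cases hr : r = 0
  · rw [hr, map_zero, poleOrder_zero]
    exact bot_le
  · exact (poleOrder_algebraMap hr).le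

lemma poleOrder_X : poleOrder ((X : R[X]) • (1 : W.CoordinateRing)) = 2 := by
  have := poleOrder_smul_basis (W := W) X 0
  rw [zero_smul, add_zero] at this
  rw [this, degree_X]
  rfl

lemma poleOrder_Y : poleOrder (mk W X) = 3 := by
  have := poleOrder_smul_basis (W := W) 0 1
  rw [zero_smul, zero_add, one_smul] at this
  rw [this, degree_one]
  rfl

lemma exists_algebraMap_of_poleOrder_le_zero {f : W.CoordinateRing} (hf : poleOrder f ≤ 0) :
    ∃ r, f = algebraMap R _ r := by
  obtain ⟨p, q, rfl⟩ := exists_smul_basis_eq f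
  rw [poleOrder_smul_basis, max_le_iff] at hf
  have hq : q = 0 := by
    by_contra hq
    rw [degree_eq_natDegree hq] at hf
    have := hf.2
    norm_cast at this
  have hp : p.degree ≤ 0 := by
    by_contra hp
    have hp0 : p ≠ 0 := by rintro rfl; simp at hp
    rw [degree_eq_natDegree hp0] at hf hp
    have := hf.1
    rw [two_nsmul] at this
    norm_cast at this hp
    omega
  refine ⟨p.coeff 0, ?_⟩
  rw [hq, zero_smul, add_zero, eq_C_of_degree_le_zero hp,
    IsScalarTower.algebraMap_apply R R[X], Algebra.smul_def, mul_one]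
  simp

lemma exists_algebraMap_of_isUnit {f : W.CoordinateRing} (hf : IsUnit f) :
    ∃ r, f = algebraMap R _ r :=
  exists_algebraMap_of_poleOrder_le_zero
    (degree_eq_zero_of_isUnit (hf.map (Algebra.norm R[X]))).le

lemma poleOrder_eval₂ {g : R →+* W.CoordinateRing} (hg : ∀ r, r ≠ 0 → poleOrder (g r) = 0)
    {x : W.CoordinateRing} {m : ℕ} (hm : 0 < m) (hx : poleOrder x = m) {P : R[X]} (hP : P ≠ 0) :
    poleOrder (P.eval₂ g x) = (P.natDegree * m : ℕ) := by
  induction hn : P.natDegree generalizing P with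
  | zero =>
    rw [eq_C_of_natDegree_eq_zero hn, eval₂_C, hg _ (by
      rwa [Ne, ← C_eq_zero, ← eq_C_of_natDegree_eq_zero hn])]
    simp
  | succ n ih =>
    have hQ : P.divX.natDegree = n := by rw [natDegree_divX_eq_natDegree_tsub_one, hn]; simp
    have hQ0 : P.divX ≠ 0 := fun h ↦ by
      rw [divX_eq_zero_iff] at h
      rw [h] at hn
      simp at hn
    have h1 : poleOrder (P.divX.eval₂ g x * x) = ((n + 1) * m : ℕ) := by
      rw [poleOrder_mul, ih hQ0 hQ, hx]
      norm_cast
      ring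
    conv_lhs => rw [← divX_mul_X_add P]
    rw [eval₂_add, eval₂_mul, eval₂_X, eval₂_C, add_comm, poleOrder_add_eq_of_lt, h1]
    rw [h1]
    have hpos : (0 : WithBot ℕ) < ((n + 1) * m : ℕ) := by
      norm_cast; positivity
    by_cases h0 : P.coeff 0 = 0
    · rw [h0, map_zero, poleOrder_zero]
      exact WithBot.bot_lt_coe _
    · rwa [hg _ h0]

/-- An isomorphism carrying constants to constants preserves the leading terms at infinity:
it multiplies pole orders by a common factor, which is one by surjectivity. -/
lemma poleOrder_map_X_Y {a b : R} (φ : (mordell a).CoordinateRing ≃+* (mordell b).CoordinateRing)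
    (σ : R → R) (hσ : ∀ r, φ (algebraMap R _ r) = algebraMap R _ (σ r))
    (hφ : ∀ r, ∃ s, φ.symm (algebraMap R _ r) = algebraMap R _ s) :
    poleOrder (φ ((X : R[X]) • 1)) = 2 ∧ poleOrder (φ (mk _ X)) = 3 := by
  set x := φ ((X : R[X]) • 1) with hx
  set y := φ (mk _ X) with hy
  have hxpos : ¬ poleOrder x ≤ 0 := fun h ↦ by
    obtain ⟨r, hr⟩ := exists_algebraMap_of_poleOrder_le_zero h
    obtain ⟨s, hs⟩ := hφ r
    rw [← hr, hx, φ.symm_apply_apply] at hs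
    have := poleOrder_X (W := mordell a)
    rw [hs] at this
    exact absurd (this.ge.trans (poleOrder_algebraMap_le s)) (by decide)
  have hσ0 (r : R) (hr : r ≠ 0) : poleOrder (φ (algebraMap R _ r)) = 0 := by
    rw [hσ, poleOrder_algebraMap]
    intro h
    have := hσ r
    rw [h, map_zero, map_eq_zero_iff _ φ.injective,
      map_eq_zero_iff _ (FaithfulSMul.algebraMap_injective _ _)] at this
    exact hr this
  obtain ⟨m, hm⟩ : ∃ m : ℕ, poleOrder x = m := by
    obtain ⟨m, hm⟩ := WithBot.ne_bot_iff_exists.mp fun h ↦ hxpos (h.trans_le bot_le)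
    exact ⟨m, hm.symm⟩
  have hmpos : 0 < m := by
    rw [hm] at hxpos
    norm_cast at hxpos
    omega
  have hyx : y ^ 2 = x ^ 3 + φ (algebraMap R _ a) := by
    rw [hx, hy, ← map_pow φ, ← map_pow φ, ← map_add, mordell_equation]
  have hy2 : 2 • poleOrder y = (3 * m : ℕ) := by
    have h3 : poleOrder (x ^ 3) = (3 * m : ℕ) := by
      rw [poleOrder_pow, hm]; norm_cast
    rw [← poleOrder_pow, hyx, add_comm, poleOrder_add_eq_of_lt, h3]
    rw [h3]
    have hpos : (0 : WithBot ℕ) < (3 * m : ℕ) := by norm_cast; omega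
    refine lt_of_le_of_lt ?_ hpos
    rw [hσ]
    exact poleOrder_algebraMap_le _
  obtain ⟨k, hk⟩ : ∃ k : ℕ, poleOrder y = k := by
    obtain ⟨k, hk⟩ := WithBot.ne_bot_iff_exists (x := poleOrder y).mp fun h ↦ by
      rw [h, two_nsmul] at hy2
      exact absurd hy2 WithBot.bot_ne_coe
    exact ⟨k, hk.symm⟩
  have hkm : k + k = 3 * m := by
    rw [hk, two_nsmul] at hy2
    exact_mod_cast hy2
  obtain ⟨e, rfl⟩ : ∃ e, m = 2 * e := ⟨m / 2, by omega⟩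
  obtain rfl : k = 3 * e := by omega
  have hdvd (f : (mordell b).CoordinateRing) (n : ℕ) (hf : poleOrder f = n) : e ∣ n := by
    obtain ⟨g, rfl⟩ := φ.surjective f
    obtain ⟨p, q, rfl⟩ := exists_smul_basis_eq g
    have hmap := map_smul_basis (φ : (mordell a).CoordinateRing →+* (mordell b).CoordinateRing) p q
    simp only [RingHom.coe_coe] at hmap
    rw [hmap, ← hx, ← hy] at hf
    have hg : ∀ r, r ≠ 0 → poleOrder
        (((φ : (mordell a).CoordinateRing →+* (mordell b).CoordinateRing).comp
          (algebraMap R _)) r) = 0 := hσ0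
    generalize (φ : (mordell a).CoordinateRing →+* (mordell b).CoordinateRing).comp
      (algebraMap R _) = g at *
    have hqy (hq : q ≠ 0) :
        poleOrder (q.eval₂ g x * y) = (q.natDegree * (2 * e) + 3 * e : ℕ) := by
      rw [poleOrder_mul, poleOrder_eval₂ hg hmpos hm hq, hk]
      norm_cast
    by_cases hp : p = 0
    · rw [hp, eval₂_zero, zero_add] at hf
      by_cases hq : q = 0
      · rw [hq, eval₂_zero, zero_mul, poleOrder_zero] at hf
        exact absurd hf (WithBot.bot_ne_coe)
      · rw [hqy hq] at hf
        norm_cast at hf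
        exact ⟨q.natDegree * 2 + 3, by rw [← hf]; ring⟩
    have hpx := poleOrder_eval₂ hg hmpos hm hp
    by_cases hq : q = 0
    · rw [hq, eval₂_zero, zero_mul, add_zero, hpx] at hf
      norm_cast at hf
      exact ⟨p.natDegree * 2, by rw [← hf]; ring⟩
    have hqy := hqy hq
    rcases lt_trichotomy (p.natDegree * (2 * e)) (q.natDegree * (2 * e) + 3 * e) with h | h | h
    · rw [poleOrder_add_eq_of_lt (by rw [hpx, hqy]; exact_mod_cast h), hqy] at hf
      norm_cast at hf
      exact ⟨q.natDegree * 2 + 3, by rw [← hf]; ring⟩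
    · have : p.natDegree * 2 = q.natDegree * 2 + 3 :=
        Nat.eq_of_mul_eq_mul_right (show 0 < e by omega) (by rw [mul_assoc, h]; ring)
      omega
    · rw [add_comm, poleOrder_add_eq_of_lt (by rw [hpx, hqy]; exact_mod_cast h), hpx] at hf
      norm_cast at hf
      exact ⟨p.natDegree * 2, by rw [← hf]; ring⟩
  have he : e = 1 := by
    have h2 := hdvd _ 2 poleOrder_X
    have h3 := hdvd _ 3 poleOrder_Y
    exact Nat.dvd_one.mp ((Nat.dvd_add_right h2).mp h3)
  subst he
  exact ⟨hm, hk⟩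

/-- If an isomorphism of coordinate rings of Mordell curves carries constants to constants,
then the two coefficients differ by both a square and a cube. -/
theorem exists_square_cube_of_ringEquiv (h2 : (2 : R) ≠ 0) (h3 : (3 : R) ≠ 0) {a b : R}
    (φ : (mordell a).CoordinateRing ≃+* (mordell b).CoordinateRing)
    (σ : R → R) (hσ : ∀ r, φ (algebraMap R _ r) = algebraMap R _ (σ r))
    (hφ : ∀ r, ∃ s, φ.symm (algebraMap R _ r) = algebraMap R _ s) :
    ∃ α γ : R, σ a = γ ^ 2 * b ∧ σ a = α ^ 3 * b := by
  obtain ⟨hx, hy⟩ := poleOrder_map_X_Y φ σ hσ hφ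
  have hyx : φ (mk _ X) ^ 2 = φ ((X : R[X]) • 1) ^ 3 + algebraMap R _ (σ a) := by
    rw [← hσ, ← map_pow φ, ← map_pow φ, ← map_add, mordell_equation]
  obtain ⟨p, q, hpq⟩ := exists_smul_basis_eq (φ ((X : R[X]) • 1))
  obtain ⟨r, s, hrs⟩ := exists_smul_basis_eq (φ (mk _ X))
  rw [← hpq, poleOrder_smul_basis] at hx
  rw [← hrs, poleOrder_smul_basis] at hy
  have hq : q = 0 := by
    by_contra hq
    have := hx.le.trans' (le_max_right _ _)
    rw [degree_eq_natDegree hq, two_nsmul] at this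
    replace this : ((q.natDegree + q.natDegree + 3 : ℕ) : WithBot ℕ) ≤ (2 : ℕ) := this
    norm_cast at this
  have hp : p.degree ≤ 1 := by
    by_cases hp : p = 0
    · simp [hp]
    have := hx.le.trans' (le_max_left _ _)
    rw [degree_eq_natDegree hp, two_nsmul] at this
    replace this : ((p.natDegree + p.natDegree : ℕ) : WithBot ℕ) ≤ (2 : ℕ) := this
    rw [degree_eq_natDegree hp]
    norm_cast at this ⊢
    omega
  have hr : 2 • r.degree ≠ 3 := by
    by_cases hr : r = 0
    · rw [hr, degree_zero, two_nsmul]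
      decide
    · rw [degree_eq_natDegree hr, two_nsmul]
      intro h
      replace h : ((r.natDegree + r.natDegree : ℕ) : WithBot ℕ) = (3 : ℕ) := h
      norm_cast at h
      omega
  have hs0 : s ≠ 0 := by
    rintro rfl
    apply hr
    simpa using hy
  have hs : s.degree ≤ 0 := by
    have := hy.le.trans' (le_max_right _ _)
    rw [degree_eq_natDegree hs0, two_nsmul] at this
    replace this : ((s.natDegree + s.natDegree + 3 : ℕ) : WithBot ℕ) ≤ (3 : ℕ) := this
    rw [degree_eq_natDegree hs0]
    norm_cast at this ⊢
    omega
  obtain ⟨γ, rfl⟩ : ∃ γ, s = C γ := ⟨_, eq_C_of_degree_le_zero hs⟩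
  obtain ⟨α, β, rfl⟩ : ∃ α β, p = C α * X + C β := ⟨_, _, eq_X_add_C_of_degree_le_one hp⟩
  have hγ : γ ≠ 0 := fun h ↦ hs0 (by rw [h, C_0])
  rw [← hpq, ← hrs, hq, zero_smul, add_zero, IsScalarTower.algebraMap_apply R R[X]] at hyx
  have hb := mordell_equation b
  rw [IsScalarTower.algebraMap_apply R R[X]] at hb
  have hlin : (r ^ 2 + C γ ^ 2 * (X ^ 3 + C b) - (C α * X + C β) ^ 3 - C (σ a)) •
      (1 : (mordell b).CoordinateRing) + (2 * r * C γ) • mk (mordell b) X = 0 := by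
    simp only [Algebra.smul_def, mul_one] at hyx hb ⊢
    simp only [map_add, map_sub, map_mul, map_pow, map_ofNat, algebraMap_eq] at hyx hb ⊢
    linear_combination hyx - (algebraMap R[X] (mordell b).CoordinateRing (C γ)) ^ 2 * hb
  obtain ⟨hA, hB⟩ := smul_basis_eq_zero hlin
  have hr0 : r = 0 := by
    have h2' : (2 : R[X]) ≠ 0 := by
      rw [← C_ofNat]; exact C_ne_zero.mpr h2
    simpa [hγ, h2'] using hB
  have hcubic : (⟨γ ^ 2 - α ^ 3, -3 * α ^ 2 * β, -3 * α * β ^ 2, γ ^ 2 * b - β ^ 3 - σ a⟩ :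
      Cubic R).toPoly = 0 := by
    rw [hr0] at hA
    simp only [Cubic.toPoly, C_sub, C_mul, C_pow, C_neg, C_ofNat]
    linear_combination hA
  obtain ⟨c3, c2, -, c0⟩ := Cubic.mk.inj ((Cubic.toPoly_eq_zero_iff _).mp hcubic)
  have hα : α ≠ 0 := by
    rintro rfl
    simp [hγ] at c3
  have hβ : β = 0 := by
    simpa [h3, hα] using c2
  refine ⟨α, γ, ?_, ?_⟩
  · rw [hβ] at c0
    linear_combination -c0
  · rw [hβ] at c0
    linear_combination -c0 + b * c3

end WeierstrassCurve.Affine.CoordinateRing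

section Cylinder

open WeierstrassCurve.Affine CoordinateRing

/-- The Laurent polynomial ring in `n + 1` variables, the first of which is `t`. -/
abbrev BaseRing (n : ℕ) : Type := AddMonoidAlgebra ℂ (ℤ × (Fin n →₀ ℤ))

/-- The inverse `t⁻¹` of the first variable. -/
noncomputable abbrev tInv (n : ℕ) : BaseRing n := AddMonoidAlgebra.single (-1, 0) 1

/-- The class of a coordinate of the ambient affine space. -/
noncomputable abbrev surfaceCoord (ℓ : ℕ) (i : Fin 3) : surfaceRing23 ℓ :=
  Ideal.Quotient.mk _ (MvPolynomial.X i)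

lemma surfaceCoord_relation (ℓ : ℕ) :
    surfaceCoord ℓ 2 ^ ℓ * (surfaceCoord ℓ 0 ^ 2 + surfaceCoord ℓ 1 ^ 3) = 1 := by
  rw [← sub_eq_zero]
  simp only [surfaceCoord, ← map_pow, ← map_add, ← map_mul]
  rw [← map_one (Ideal.Quotient.mk _), ← map_sub, Ideal.Quotient.eq_zero_iff_mem]
  exact Ideal.subset_span rfl

/-- The universal property of `surfaceRing23`. -/
noncomputable def surfaceLift {T : Type*} [CommRing T] [Algebra ℂ T] (ℓ : ℕ) (v : Fin 3 → T)
    (h : v 2 ^ ℓ * (v 0 ^ 2 + v 1 ^ 3) = 1) : surfaceRing23 ℓ →ₐ[ℂ] T :=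
  Ideal.Quotient.liftₐ _ (MvPolynomial.aeval v) fun f hf ↦ by
    rw [← RingHom.mem_ker]
    refine (Ideal.span_le.mpr ?_ : _ ≤ RingHom.ker (MvPolynomial.aeval (R := ℂ) v)) hf
    rintro _ rfl
    simp [h]

lemma surfaceLift_coord {T : Type*} [CommRing T] [Algebra ℂ T] (ℓ : ℕ) (v : Fin 3 → T)
    (h : v 2 ^ ℓ * (v 0 ^ 2 + v 1 ^ 3) = 1) (i : Fin 3) :
    surfaceLift ℓ v h (surfaceCoord ℓ i) = v i := by
  exact MvPolynomial.aeval_X v i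

/-- For `ℓ ≠ 0`, the coordinate `t` is invertible on the surface. -/
noncomputable def surfaceUnit {ℓ : ℕ} (hℓ : ℓ ≠ 0) : (surfaceRing23 ℓ)ˣ :=
  Units.mkOfMulEqOne (surfaceCoord ℓ 2)
    (surfaceCoord ℓ 2 ^ (ℓ - 1) * (surfaceCoord ℓ 0 ^ 2 + surfaceCoord ℓ 1 ^ 3)) (by
      rw [← mul_assoc, mul_pow_sub_one hℓ, surfaceCoord_relation])

lemma coe_surfaceUnit {ℓ : ℕ} (hℓ : ℓ ≠ 0) :
    (surfaceUnit hℓ : surfaceRing23 ℓ) = surfaceCoord ℓ 2 :=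
  rfl

/-- The base Laurent polynomial ring as a subring of the cylinder. -/
noncomputable def baseToCylinder {ℓ : ℕ} (hℓ : ℓ ≠ 0) (n : ℕ) :
    BaseRing n →ₐ[ℂ] surfaceRing23 ℓ ⊗[ℂ] laurentRing n :=
  AddMonoidAlgebra.lift ℂ _ _
    { toFun m := ((surfaceUnit hℓ ^ m.toAdd.1 : (surfaceRing23 ℓ)ˣ) : surfaceRing23 ℓ) ⊗ₜ
        AddMonoidAlgebra.single m.toAdd.2 1
      map_one' := by simp [Algebra.TensorProduct.one_def, AddMonoidAlgebra.one_def]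
      map_mul' x y := by
        simp [zpow_add, AddMonoidAlgebra.single_mul_single] }

lemma baseToCylinder_single {ℓ : ℕ} (hℓ : ℓ ≠ 0) (n : ℕ) (m : ℤ × (Fin n →₀ ℤ)) :
    baseToCylinder hℓ n (AddMonoidAlgebra.single m 1) =
      ((surfaceUnit hℓ ^ m.1 : (surfaceRing23 ℓ)ˣ) : surfaceRing23 ℓ) ⊗ₜ
        AddMonoidAlgebra.single m.2 1 := by
  simp [baseToCylinder]

/-- The cylinder maps to the Mordell curve over the base torus. -/
noncomputable def cylinderToCurve (ℓ n : ℕ) :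
    surfaceRing23 ℓ ⊗[ℂ] laurentRing n →ₐ[ℂ] (mordell (tInv n ^ ℓ)).CoordinateRing :=
  Algebra.TensorProduct.lift
    (surfaceLift ℓ ![mk _ Polynomial.X, -((Polynomial.X : Polynomial (BaseRing n)) • 1),
        algebraMap (BaseRing n) _ (AddMonoidAlgebra.single (1, 0) 1)] (by
      have h := mordell_equation (tInv n ^ ℓ)
      have hu : (AddMonoidAlgebra.single (1, 0) 1 : BaseRing n) ^ ℓ * tInv n ^ ℓ = 1 := by
        rw [← mul_pow, AddMonoidAlgebra.single_mul_single]
        simp [← AddMonoidAlgebra.one_def, ← Prod.zero_eq_mk]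
      have hu' := congrArg (algebraMap (BaseRing n) (mordell (tInv n ^ ℓ)).CoordinateRing) hu
      rw [map_mul, map_one, map_pow] at hu'
      simp only [Matrix.cons_val]
      rw [h, ← hu']
      ring))
    ((Algebra.ofId (BaseRing n) _).restrictScalars ℂ |>.comp
      (AddMonoidAlgebra.mapDomainAlgHom ℂ ℂ (AddMonoidHom.inr ℤ (Fin n →₀ ℤ))))
    fun _ _ ↦ Commute.all _ _

lemma surfaceUnit_inv_pow {ℓ : ℕ} (hℓ : ℓ ≠ 0) :
    (((surfaceUnit hℓ)⁻¹ : (surfaceRing23 ℓ)ˣ) : surfaceRing23 ℓ) ^ ℓ =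
      surfaceCoord ℓ 0 ^ 2 + surfaceCoord ℓ 1 ^ 3 := by
  rw [← Units.val_pow_eq_pow_val, inv_pow, ← mul_one (Units.val _), ← surfaceCoord_relation ℓ,
    ← coe_surfaceUnit hℓ, ← Units.val_pow_eq_pow_val, Units.inv_mul_cancel_left]

lemma baseToCylinder_relation {ℓ : ℕ} (hℓ : ℓ ≠ 0) (n : ℕ) :
    (surfaceCoord ℓ 0 ⊗ₜ[ℂ] (1 : laurentRing n)) ^ 2 =
      ((-surfaceCoord ℓ 1) ⊗ₜ[ℂ] (1 : laurentRing n)) ^ 3 + baseToCylinder hℓ n (tInv n ^ ℓ) := by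
  have h : baseToCylinder hℓ n (tInv n ^ ℓ) = baseToCylinder hℓ n (tInv n) ^ ℓ :=
    map_pow (baseToCylinder hℓ n).toRingHom _ _
  rw [h, baseToCylinder_single, ← AddMonoidAlgebra.one_def]
  simp only [Algebra.TensorProduct.tmul_pow, one_pow, zpow_neg_one]
  rw [surfaceUnit_inv_pow, ← TensorProduct.add_tmul]
  ring_nf

/-- The Mordell curve over the base torus maps to the cylinder. -/
noncomputable def curveToCylinder {ℓ : ℕ} (hℓ : ℓ ≠ 0) (n : ℕ) :
    (mordell (tInv n ^ ℓ)).CoordinateRing →ₐ[ℂ] surfaceRing23 ℓ ⊗[ℂ] laurentRing n :=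
  mordellLift (baseToCylinder hℓ n) ((-surfaceCoord ℓ 1) ⊗ₜ[ℂ] (1 : laurentRing n))
    (surfaceCoord ℓ 0 ⊗ₜ[ℂ] (1 : laurentRing n))
    (baseToCylinder_relation hℓ n)

lemma cylinderToCurve_coord (ℓ n : ℕ) (i : Fin 3) :
    cylinderToCurve ℓ n (surfaceCoord ℓ i ⊗ₜ 1) =
      ![mk _ Polynomial.X, -((Polynomial.X : Polynomial (BaseRing n)) • 1),
        algebraMap (BaseRing n) _ (AddMonoidAlgebra.single (1, 0) 1)] i := by
  rw [cylinderToCurve, Algebra.TensorProduct.lift_tmul, surfaceLift_coord, map_one, mul_one]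

lemma cylinderToCurve_single (ℓ n : ℕ) (m : Fin n →₀ ℤ) :
    cylinderToCurve ℓ n (1 ⊗ₜ AddMonoidAlgebra.single m 1) =
      algebraMap (BaseRing n) _ (AddMonoidAlgebra.single (0, m) 1) := by
  rw [cylinderToCurve, Algebra.TensorProduct.lift_tmul, map_one, one_mul, AlgHom.comp_apply]
  simp [AddMonoidAlgebra.mapDomainAlgHom_apply, Algebra.ofId_apply]

lemma cylinderToCurve_baseToCylinder {ℓ : ℕ} (hℓ : ℓ ≠ 0) (n : ℕ) (r : BaseRing n) :
    cylinderToCurve ℓ n (baseToCylinder hℓ n r) = algebraMap (BaseRing n) _ r := by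
  suffices h : (cylinderToCurve ℓ n).comp (baseToCylinder hℓ n) =
      (Algebra.ofId (BaseRing n) (mordell (tInv n ^ ℓ)).CoordinateRing).restrictScalars ℂ from
    DFunLike.congr_fun h r
  refine AddMonoidAlgebra.algHom_ext (fun ⟨k, m⟩ ↦ ?_) (Subsingleton.elim _ _)
  have hunit (k : ℤ) : cylinderToCurve ℓ n
      (((surfaceUnit hℓ ^ k : (surfaceRing23 ℓ)ˣ) : surfaceRing23 ℓ) ⊗ₜ 1) =
        algebraMap (BaseRing n) _ (AddMonoidAlgebra.single (k, 0) 1) := by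
    let f : surfaceRing23 ℓ →* (mordell (tInv n ^ ℓ)).CoordinateRing :=
      ((cylinderToCurve ℓ n).comp Algebra.TensorProduct.includeLeft : _ →ₐ[ℂ] _)
    let g : BaseRing n →* (mordell (tInv n ^ ℓ)).CoordinateRing :=
      (algebraMap (BaseRing n) (mordell (tInv n ^ ℓ)).CoordinateRing).toMonoidHom
    have h : (f.comp (Units.coeHom _)).comp (zpowersHom _ (surfaceUnit hℓ)) =
        g.comp ((AddMonoidAlgebra.of ℂ _).comp
          (AddMonoidHom.toMultiplicative (AddMonoidHom.inl ℤ (Fin n →₀ ℤ)))) := by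
      refine MonoidHom.ext_mint ?_
      simpa [f, g, coe_surfaceUnit] using cylinderToCurve_coord ℓ n 2
    exact DFunLike.congr_fun h (Multiplicative.ofAdd k)
  rw [AlgHom.comp_apply, baseToCylinder_single, ← mul_one (Units.val _),
    ← one_mul (AddMonoidAlgebra.single _ _), ← Algebra.TensorProduct.tmul_mul_tmul, map_mul,
    hunit, cylinderToCurve_single, ← map_mul, AddMonoidAlgebra.single_mul_single]
  simp [Algebra.ofId_apply]

/-- The cylinder is the coordinate ring of a Mordell curve over the base torus. -/
noncomputable def cylinderEquivCurve {ℓ : ℕ} (hℓ : ℓ ≠ 0) (n : ℕ) :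
    surfaceRing23 ℓ ⊗[ℂ] laurentRing n ≃ₐ[ℂ] (mordell (tInv n ^ ℓ)).CoordinateRing :=
  AlgEquiv.ofAlgHom (cylinderToCurve ℓ n) (curveToCylinder hℓ n)
    (algHom_ext_of_basis
      (fun r ↦ by
        rw [AlgHom.comp_apply, curveToCylinder, mordellLift_algebraMap,
          cylinderToCurve_baseToCylinder, AlgHom.id_apply])
      (by rw [AlgHom.comp_apply, curveToCylinder, mordellLift_X, TensorProduct.neg_tmul, map_neg,
          cylinderToCurve_coord]
          simp)
      (by rw [AlgHom.comp_apply, curveToCylinder, mordellLift_Y, cylinderToCurve_coord]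
          simp))
    (Algebra.TensorProduct.ext
      (Ideal.Quotient.algHom_ext _ (MvPolynomial.algHom_ext fun i ↦ by
        change curveToCylinder hℓ n (cylinderToCurve ℓ n (surfaceCoord ℓ i ⊗ₜ 1)) =
          surfaceCoord ℓ i ⊗ₜ 1
        rw [cylinderToCurve_coord, curveToCylinder]
        fin_cases i
        · exact mordellLift_Y _ _ _ _
        · simp [mordellLift_X, TensorProduct.neg_tmul]
        · simp [mordellLift_algebraMap, baseToCylinder_single, coe_surfaceUnit,
            ← AddMonoidAlgebra.one_def]))
      (AddMonoidAlgebra.algHom_ext (fun m ↦ by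
        change curveToCylinder hℓ n (cylinderToCurve ℓ n (1 ⊗ₜ AddMonoidAlgebra.single m 1)) =
          1 ⊗ₜ AddMonoidAlgebra.single m 1
        rw [cylinderToCurve_single, curveToCylinder, mordellLift_algebraMap,
          baseToCylinder_single]
        simp) (Subsingleton.elim _ _)))

/-- Algebra homomorphisms carry the base torus to the base torus, whose coordinate ring is spanned
by units. -/
lemma exists_map_algebraMap {n : ℕ} {W W' : WeierstrassCurve.Affine (BaseRing n)}
    (φ : W.CoordinateRing →ₐ[ℂ] W'.CoordinateRing) (r : BaseRing n) :
    ∃ s, φ (algebraMap _ _ r) = algebraMap (BaseRing n) _ s := by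
  induction r using AddMonoidAlgebra.induction_on with
  | of m =>
    have hm : IsUnit (AddMonoidAlgebra.of ℂ (ℤ × (Fin n →₀ ℤ)) m) :=
      (Group.isUnit (Multiplicative.ofAdd m)).map (AddMonoidAlgebra.of ℂ _)
    exact exists_algebraMap_of_isUnit ((hm.map (algebraMap _ W.CoordinateRing)).map φ)
  | add f g hf hg =>
    obtain ⟨s, hs⟩ := hf
    obtain ⟨s', hs'⟩ := hg
    exact ⟨s + s', by rw [map_add, map_add, map_add, hs, hs']⟩
  | smul c f hf =>
    obtain ⟨s, hs⟩ := hf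
    refine ⟨c • s, ?_⟩
    rw [Algebra.algebraMap_eq_smul_one, smul_assoc, ← Algebra.algebraMap_eq_smul_one, map_smul, hs,
      Algebra.algebraMap_eq_smul_one, Algebra.algebraMap_eq_smul_one, smul_assoc]

/-- The projection of the base torus to its first factor, on rational functions. -/
noncomputable def baseToRatFunc (n : ℕ) : BaseRing n →ₐ[ℂ] RatFunc ℂ :=
  AddMonoidAlgebra.lift ℂ _ _
    { toFun m := RatFunc.X ^ m.toAdd.1
      map_one' := by simp
      map_mul' x y := zpow_add₀ RatFunc.X_ne_zero _ _ }

lemma baseToRatFunc_tInv (n : ℕ) : baseToRatFunc n (tInv n) = RatFunc.X⁻¹ := by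
  simp [baseToRatFunc]

lemma RatFunc.intDegree_pow {K : Type*} [Field K] {x : RatFunc K} (hx : x ≠ 0) (k : ℕ) :
    (x ^ k).intDegree = k * x.intDegree := by
  induction k with
  | zero => simp
  | succ k ih =>
    rw [pow_succ, RatFunc.intDegree_mul (pow_ne_zero k hx) hx, ih]
    push_cast
    ring

/-- An isomorphism of cylinders forces `ℓ d = 2γ - ℓ' = 3α - ℓ'`, where `d` is the degree
in `t` of the image of `t⁻¹`. -/
lemma exists_degree_relation {ℓ ℓ' : ℕ} (hℓ : ℓ ≠ 0) (hℓ' : ℓ' ≠ 0) {n : ℕ}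
    (e : (surfaceRing23 ℓ ⊗[ℂ] laurentRing n) ≃ₐ[ℂ] (surfaceRing23 ℓ' ⊗[ℂ] laurentRing n)) :
    ∃ d α γ : ℤ, ℓ * d = 2 * γ - ℓ' ∧ ℓ * d = 3 * α - ℓ' := by
  let φ := ((cylinderEquivCurve hℓ n).symm.trans e).trans (cylinderEquivCurve hℓ' n)
  choose σ hσ using exists_map_algebraMap φ.toAlgHom
  have hinj : Function.Injective
      (algebraMap (BaseRing n) (mordell (tInv n ^ ℓ')).CoordinateRing) :=
    FaithfulSMul.algebraMap_injective _ _
  have hσmul (r s : BaseRing n) : σ (r * s) = σ r * σ s :=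
    hinj (by rw [← hσ, map_mul, map_mul, map_mul, hσ, hσ])
  have hσone : σ 1 = 1 := hinj (by rw [← hσ, map_one, map_one, map_one])
  let σ' : BaseRing n →* BaseRing n := ⟨⟨σ, hσone⟩, hσmul⟩
  have hn (k : ℕ) (hk : k ≠ 0) : (k : BaseRing n) ≠ 0 := by
    rw [← map_natCast (algebraMap ℂ (BaseRing n)), Ne,
      map_eq_zero_iff _ (FaithfulSMul.algebraMap_injective _ _)]
    exact_mod_cast hk
  obtain ⟨α, γ, hγ, hα⟩ := exists_square_cube_of_ringEquiv (by exact_mod_cast hn 2 two_ne_zero)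
    (by exact_mod_cast hn 3 three_ne_zero) φ.toRingEquiv σ hσ
    (exists_map_algebraMap φ.symm.toAlgHom)
  have hunit : IsUnit (tInv n) :=
    (Group.isUnit (Multiplicative.ofAdd ((-1, 0) : ℤ × (Fin n →₀ ℤ)))).map
      (AddMonoidAlgebra.of ℂ _)
  have hs : baseToRatFunc n (σ (tInv n)) ≠ 0 := ((hunit.map σ').map (baseToRatFunc n)).ne_zero
  have hpow : σ (tInv n ^ ℓ) = σ (tInv n) ^ ℓ := map_pow σ' _ _
  rw [hpow] at hγ hα
  have hdeg (β : BaseRing n) (k : ℕ) (hk : k ≠ 0)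
      (h : σ (tInv n) ^ ℓ = β ^ k * tInv n ^ ℓ') :
      ℓ * (baseToRatFunc n (σ (tInv n))).intDegree = k * (baseToRatFunc n β).intDegree - ℓ' := by
    have h' := congrArg (baseToRatFunc n) h
    simp only [map_mul, map_pow, baseToRatFunc_tInv] at h'
    have hβ : baseToRatFunc n β ≠ 0 := by
      intro h0
      rw [h0, zero_pow hk, zero_mul] at h'
      exact pow_ne_zero ℓ hs h'
    have hX : (RatFunc.X⁻¹ : RatFunc ℂ) ≠ 0 := inv_ne_zero RatFunc.X_ne_zero
    have := congrArg RatFunc.intDegree h'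
    rw [RatFunc.intDegree_mul (pow_ne_zero k hβ) (pow_ne_zero ℓ' hX), RatFunc.intDegree_pow hs,
      RatFunc.intDegree_pow hβ, RatFunc.intDegree_pow hX, RatFunc.intDegree_inv,
      RatFunc.intDegree_X] at this
    linarith
  exact ⟨_, _, _, hdeg γ 2 two_ne_zero hγ, hdeg α 3 three_ne_zero hα⟩

end Cylinder

/-- **Lemma (the case `(p,q)=(2,3)`).** For distinct `ℓ, ℓ' ∈ {1,2,3}` and every `n ≥ 0`,
the coordinate rings of `X̃_{f,ℓ} × (𝔸¹_*)ⁿ` and `X̃_{f,ℓ'} × (𝔸¹_*)ⁿ`, i.e.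
`B_ℓ ⊗_ℂ Lₙ` and `B_{ℓ'} ⊗_ℂ Lₙ`, are not isomorphic as `ℂ`-algebras. -/
theorem case23_cylinders_not_iso (ℓ ℓ' : ℕ) (hℓ : ℓ ∈ ({1, 2, 3} : Set ℕ))
    (hℓ' : ℓ' ∈ ({1, 2, 3} : Set ℕ)) (hne : ℓ ≠ ℓ') (n : ℕ) :
    ¬ Nonempty ((surfaceRing23 ℓ ⊗[ℂ] laurentRing n) ≃ₐ[ℂ]
      (surfaceRing23 ℓ' ⊗[ℂ] laurentRing n)) := by
  rintro ⟨e⟩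
  have h0 (k : ℕ) (hk : k ∈ ({1, 2, 3} : Set ℕ)) : k ≠ 0 := by
    rintro rfl
    simp at hk
  obtain ⟨d, α, γ, h₁, h₂⟩ := exists_degree_relation (h0 ℓ hℓ) (h0 ℓ' hℓ') e
  obtain ⟨d', α', γ', h₁', h₂'⟩ := exists_degree_relation (h0 ℓ' hℓ') (h0 ℓ hℓ) e.symm
  rcases hℓ with rfl | rfl | rfl <;> rcases hℓ' with rfl | rfl | rfl <;> push_cast at * <;> omega
end

section
/- Let p ≥ 2 be a prime number, let q ≥ 3 be an integer with gcd(p, q) = 1, and let ℓ ≥ 2 be an integer with gcd(ℓ, pq) = 1 and such that ℓ is congruent neither to 1 nor to −1 modulo pq. Let A₁ = ℂ[x,y,t]/(t(x^p + y^q) − 1) and A_ℓ = ℂ[x,y,t]/(t^ℓ(x^p + y^q) − 1). Then the ℂ-algebras A₁ and A_ℓ are not isomorphic, but the Laurent polynomial rings A₁[u,u⁻¹] and A_ℓ[u,u⁻¹] (i.e. LaurentPolynomial A₁ and LaurentPolynomial A_ℓ) are isomorphic as ℂ-algebras. -/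
/-- `A_ℓ = ℂ[x,y,t]/(t^ℓ(x^p + y^q) - 1)`, the coordinate ring of the surface
`X̃_{f,ℓ} ⊂ 𝔸³` for `f = x^p + y^q`. -/
noncomputable abbrev surfaceRingPQ (p q ℓ : ℕ) : Type :=
  MvPolynomial (Fin 3) ℂ ⧸ Ideal.span
    {(MvPolynomial.X 2 : MvPolynomial (Fin 3) ℂ) ^ ℓ *
      ((MvPolynomial.X 0) ^ p + (MvPolynomial.X 1) ^ q) - 1}

section

open Polynomial

theorem AddValuation.exists_map_sum_eq {L Γ ι : Type*} [Ring L]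
    [LinearOrderedAddCommMonoidWithTop Γ] (v : AddValuation L Γ) (s : Finset ι)
    (hs : s.Nonempty) (f : ι → L) (hf : Set.InjOn (fun i ↦ v (f i)) s) :
    ∃ i ∈ s, v (∑ j ∈ s, f j) = v (f i) ∧ ∀ j ∈ s, v (f i) ≤ v (f j) := by
  classical
  obtain ⟨i, hi, hmin⟩ := s.exists_min_image (fun i ↦ v (f i)) hs
  refine ⟨i, hi, ?_, hmin⟩
  by_cases htop : v (f i) = ⊤
  · rw [htop]
    exact top_le_iff.1 (v.map_le_sum fun j hj ↦ htop ▸ hmin j hj)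
  rw [← Finset.add_sum_erase s f hi]
  refine v.map_add_eq_of_lt_left (v.map_lt_sum htop fun j hj ↦ ?_)
  obtain ⟨hji, hj⟩ := Finset.mem_erase.1 hj
  exact lt_of_le_of_ne (hmin j hj) fun h ↦ hji (hf hj hi h.symm)

section Weights

variable {R L : Type*} [CommRing R] [CommRing L]

theorem coe_nsmul_withTop (n : ℕ) (a : ℤ) : n • (a : WithTop ℤ) = ((n * a : ℤ) : WithTop ℤ) := by
  rw [← WithTop.coe_nsmul, nsmul_eq_mul]

theorem AddValuation.map_eval₂_of_neg (v : AddValuation L (WithTop ℤ)) (f : R →+* L)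
    (hf : ∀ c, c ≠ 0 → v (f c) = 0) {y : L} {m : ℕ} (hm : 0 < m)
    (hy : v y = ((-m : ℤ) : WithTop ℤ)) {P : R[X]} (hP : P ≠ 0) :
    v (P.eval₂ f y) = ((-(m * P.natDegree) : ℤ) : WithTop ℤ) := by
  have key : ∀ i ∈ P.support, v (f (P.coeff i) * y ^ i) = ((-(m * i) : ℤ) : WithTop ℤ) := by
    intro i hi
    rw [v.map_mul, hf _ (mem_support_iff.1 hi), v.map_pow, hy, coe_nsmul_withTop, zero_add]
    congr 1; ring
  have hm' : (m : ℤ) ≠ 0 := by exact_mod_cast hm.ne'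
  obtain ⟨i, hi, h1, h2⟩ := v.exists_map_sum_eq P.support (nonempty_support_iff.2 hP)
    (fun i ↦ f (P.coeff i) * y ^ i) (by
      intro i hi j hj hij
      simp only at hij
      rw [key i hi, key j hj, WithTop.coe_eq_coe] at hij
      have := mul_left_cancel₀ hm' (neg_inj.1 hij)
      exact_mod_cast this)
  rw [eval₂_eq_sum, Polynomial.sum, h1, key i hi]
  have h3 := h2 _ (natDegree_mem_support_of_nonzero hP)
  rw [key i hi, key _ (natDegree_mem_support_of_nonzero hP), WithTop.coe_le_coe] at h3
  have h4 : P.natDegree ≤ i := by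
    have : (m : ℤ) * P.natDegree ≤ m * i := by linarith
    exact_mod_cast le_of_mul_le_mul_left this (by exact_mod_cast hm)
  rw [le_antisymm (le_natDegree_of_mem_supp i hi) h4]

/-- Evaluation of a polynomial in two variables: the outer variable at `x`, the inner one at `y`. -/
noncomputable def biEval (f : R →+* L) (x y : L) : R[X][X] →+* L :=
  eval₂RingHom (eval₂RingHom f y) x

theorem AddValuation.exists_map_biEval (v : AddValuation L (WithTop ℤ)) (f : R →+* L)
    (hf : ∀ c, c ≠ 0 → v (f c) = 0) {x y : L} {p q k : ℕ} (hk : 0 < k) (hp : 0 < p)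
    (hpq : p.Coprime q) (hx : v x = ((-(k * q : ℕ) : ℤ) : WithTop ℤ))
    (hy : v y = ((-(k * p : ℕ) : ℤ) : WithTop ℤ)) {G : R[X][X]} (hG : G ≠ 0)
    (hGp : G.natDegree < p) :
    ∃ i, G.coeff i ≠ 0 ∧
      v (biEval f x y G) = ((-(k * (q * i + p * (G.coeff i).natDegree)) : ℤ) : WithTop ℤ) ∧
      ∀ j, G.coeff j ≠ 0 →
        q * j + p * (G.coeff j).natDegree ≤ q * i + p * (G.coeff i).natDegree := by
  have key : ∀ i ∈ G.support, v ((G.coeff i).eval₂ f y * x ^ i) =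
      ((-(k * (q * i + p * (G.coeff i).natDegree)) : ℤ) : WithTop ℤ) := by
    intro i hi
    rw [v.map_mul, v.map_eval₂_of_neg f hf (Nat.mul_pos hk hp) hy (mem_support_iff.1 hi),
      v.map_pow, hx, coe_nsmul_withTop, ← WithTop.coe_add]
    congr 1; push_cast; ring
  have hk' : (k : ℤ) ≠ 0 := by exact_mod_cast hk.ne'
  obtain ⟨i, hi, h1, h2⟩ := v.exists_map_sum_eq G.support (nonempty_support_iff.2 hG)
    (fun i ↦ (G.coeff i).eval₂ f y * x ^ i) (by
      intro i hi j hj hij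
      simp only at hij
      rw [key i hi, key j hj, WithTop.coe_eq_coe] at hij
      have h := mul_left_cancel₀ hk' (neg_inj.1 hij)
      have h' : q * i + p * (G.coeff i).natDegree = q * j + p * (G.coeff j).natDegree := by
        exact_mod_cast h
      have hmod : q * i ≡ q * j [MOD p] := by
        have := congrArg (· % p) h'
        simpa [Nat.ModEq, Nat.add_mul_mod_self_left] using this
      have := Nat.ModEq.cancel_left_of_coprime (c := q) hpq hmod
      have hi' := (le_natDegree_of_mem_supp i hi).trans_lt hGp
      have hj' := (le_natDegree_of_mem_supp j hj).trans_lt hGp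
      rwa [Nat.ModEq, Nat.mod_eq_of_lt hi', Nat.mod_eq_of_lt hj'] at this)
  refine ⟨i, mem_support_iff.1 hi, ?_, fun j hj ↦ ?_⟩
  · rw [biEval, coe_eval₂RingHom, eval₂_eq_sum, Polynomial.sum]
    simpa only [coe_eval₂RingHom] using h1.trans (key i hi)
  · have h3 := h2 j (mem_support_iff.2 hj)
    rw [key i hi, key j (mem_support_iff.2 hj), WithTop.coe_le_coe] at h3
    have : (k : ℤ) * (q * j + p * (G.coeff j).natDegree) ≤
      k * (q * i + p * (G.coeff i).natDegree) := by linarith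
    exact_mod_cast le_of_mul_le_mul_left this (by exact_mod_cast hk)

end Weights

theorem exists_powerSeries_pow_eq_one_sub {R : Type*} [CommRing R] [Algebra ℂ R] (r : R) {p m : ℕ}
    (hp : p ≠ 0) (hm : m ≠ 0) :
    ∃ u : PowerSeries R, u ^ p = 1 - PowerSeries.C r * PowerSeries.X ^ m := by
  set I : Ideal (PowerSeries R) := Ideal.span {PowerSeries.X}
  obtain ⟨a, ha, -⟩ := HenselianRing.is_henselian (R := PowerSeries R) (I := I)
    (X ^ p - C (1 - PowerSeries.C r * PowerSeries.X ^ m)) (monic_X_pow_sub_C _ hp) 1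
    (by
      rw [eval_sub, eval_pow, eval_X, eval_C, one_pow, sub_sub_cancel]
      exact Ideal.mul_mem_left _ _ (Ideal.pow_mem_of_mem _ (Ideal.mem_span_singleton_self _) _
        (Nat.pos_of_ne_zero hm)))
    (by
      apply IsUnit.map
      have : IsUnit ((p : ℂ)) := by simpa using hp
      simpa [derivative_sub, derivative_X_pow, -map_sub] using
        this.map (algebraMap ℂ (PowerSeries R)))
  refine ⟨a, ?_⟩
  simpa [IsRoot, sub_eq_zero] using ha

theorem LaurentSeries.exists_fermat_curve_point {R : Type*} [CommRing R] [IsDomain R] [Algebra ℂ R]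
    (r : R) {p q : ℕ} (hp : p ≠ 0) (hq : q ≠ 0) :
    ∃ x y : HahnSeries ℤ R, x ^ p + y ^ q = HahnSeries.C r ∧
      HahnSeries.addVal ℤ R x = ((-q : ℤ) : WithTop ℤ) ∧
      HahnSeries.addVal ℤ R y = ((-p : ℤ) : WithTop ℤ) := by
  obtain ⟨u, hu⟩ := exists_powerSeries_pow_eq_one_sub r hp (mul_ne_zero hp hq)
  obtain ⟨α, hα⟩ := IsAlgClosed.exists_pow_nat_eq (-1 : ℂ) (Nat.pos_of_ne_zero hp)
  set v := HahnSeries.addVal ℤ R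
  set y : HahnSeries ℤ R := HahnSeries.single (-p : ℤ) 1
  set x : HahnSeries ℤ R := HahnSeries.C (algebraMap ℂ R α) * HahnSeries.single (-q : ℤ) 1 *
    HahnSeries.ofPowerSeries ℤ R u
  have hyv : v y = ((-p : ℤ) : WithTop ℤ) := by
    rw [HahnSeries.addVal_apply, HahnSeries.orderTop_single one_ne_zero]
  have hx : x ^ p = HahnSeries.C r - y ^ q := by
    rw [mul_pow, mul_pow, ← map_pow, ← map_pow, ← map_pow (HahnSeries.ofPowerSeries ℤ R), hα, hu]
    simp only [y, HahnSeries.single_pow, one_pow, map_sub, map_mul, map_neg, map_one, map_pow,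
      HahnSeries.ofPowerSeries_C, HahnSeries.ofPowerSeries_X, nsmul_one]
    have h1 : (p • (-(q : ℤ)) : ℤ) = -(p * q : ℕ) := by simp
    have h2 : (q • (-(p : ℤ)) : ℤ) = -(p * q : ℕ) := by simp [mul_comm]
    rw [h1, h2]
    have h3 : HahnSeries.single (-(p * q : ℕ) : ℤ) (1 : R) *
      HahnSeries.single ((p * q : ℕ) : ℤ) (1 : R) = 1 := by
      rw [HahnSeries.single_mul_single]; simp
    linear_combination (HahnSeries.C r) * h3
  refine ⟨x, y, by rw [hx]; ring, ?_, hyv⟩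
  have hpq : (0 : ℤ) < p * q := by positivity
  have hyq : v (y ^ q) = ((-(p * q) : ℤ) : WithTop ℤ) := by
    rw [v.map_pow, hyv, coe_nsmul_withTop]; congr 1; ring
  have hxp : v (x ^ p) = ((-(p * q) : ℤ) : WithTop ℤ) := by
    rw [hx, sub_eq_add_neg, v.map_add_eq_of_lt_right, v.map_neg, hyq]
    rw [v.map_neg, hyq]
    refine lt_of_lt_of_le (b := ((0 : ℤ) : WithTop ℤ)) (WithTop.coe_lt_coe.2 (by omega)) ?_
    rw [HahnSeries.addVal_apply]
    exact HahnSeries.le_orderTop_iff_forall.2 fun j hj ↦ by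
      rw [HahnSeries.C_apply, HahnSeries.coeff_single_of_ne]
      rintro rfl
      exact lt_irrefl _ hj
  rw [v.map_pow] at hxp
  cases hvx : v x with
  | top =>
    obtain ⟨n, rfl⟩ := Nat.exists_eq_succ_of_ne_zero hp
    rw [hvx, succ_nsmul, WithTop.add_top] at hxp
    exact absurd hxp WithTop.top_ne_coe
  | coe a =>
    rw [hvx, coe_nsmul_withTop, WithTop.coe_eq_coe] at hxp
    congr 1
    have : (p : ℤ) ≠ 0 := by exact_mod_cast hp
    exact mul_left_cancel₀ this (by linarith)

section Scaling

variable {R L : Type*} [CommRing R] [CommRing L]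

theorem nonneg_of_nonneg_nsmul {n : ℕ} (hn : n ≠ 0) {a : WithTop ℤ} (h : 0 ≤ n • a) : 0 ≤ a := by
  cases a with
  | top => exact le_top
  | coe a =>
    rw [coe_nsmul_withTop, ← WithTop.coe_zero, WithTop.coe_le_coe] at h
    rw [← WithTop.coe_zero, WithTop.coe_le_coe]
    exact nonneg_of_mul_nonneg_right h (by positivity)

theorem AddValuation.biEval_nonneg (v : AddValuation L (WithTop ℤ)) (f : R →+* L)
    (hf : ∀ c, c ≠ 0 → v (f c) = 0) {x y : L} (hx : 0 ≤ v x) (hy : 0 ≤ v y) (G : R[X][X]) :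
    0 ≤ v (biEval f x y G) := by
  have hf' : ∀ c, 0 ≤ v (f c) := fun c ↦ by
    by_cases hc : c = 0
    · simp [hc]
    · exact (hf c hc).ge
  have hev : ∀ P : R[X], 0 ≤ v (P.eval₂ f y) := fun P ↦ by
    rw [eval₂_eq_sum, Polynomial.sum]
    refine v.map_le_sum fun i _ ↦ ?_
    rw [v.map_mul, v.map_pow]
    exact add_nonneg (hf' _) (nsmul_nonneg hy _)
  rw [biEval, coe_eval₂RingHom, eval₂_eq_sum, Polynomial.sum]
  refine v.map_le_sum fun i _ ↦ ?_
  rw [v.map_mul, v.map_pow]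
  exact add_nonneg (hev _) (nsmul_nonneg hx _)

theorem AddValuation.exists_weights_of_pow_add_pow (v : AddValuation L (WithTop ℤ)) {X Y : L}
    {p q : ℕ} (hp : p ≠ 0) (hq : q ≠ 0) (hpq : p.Coprime q) (h : v (X ^ p + Y ^ q) = 0)
    (hXY : ¬ (0 ≤ v X ∧ 0 ≤ v Y)) :
    ∃ k : ℕ, 0 < k ∧ v X = ((-(k * q : ℕ) : ℤ) : WithTop ℤ) ∧
      v Y = ((-(k * p : ℕ) : ℤ) : WithTop ℤ) := by
  have heq : v (X ^ p) = v (Y ^ q) := by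
    by_contra hne
    refine hXY ?_
    rcases lt_or_gt_of_ne hne with hlt | hlt
    · rw [v.map_add_eq_of_lt_left hlt] at h
      rw [h] at hlt
      rw [v.map_pow] at h hlt
      exact ⟨nonneg_of_nonneg_nsmul hp h.ge, nonneg_of_nonneg_nsmul hq hlt.le⟩
    · rw [v.map_add_eq_of_lt_right hlt] at h
      rw [h] at hlt
      rw [v.map_pow] at h hlt
      exact ⟨nonneg_of_nonneg_nsmul hp hlt.le, nonneg_of_nonneg_nsmul hq h.ge⟩
  rw [v.map_pow, v.map_pow] at heq
  cases hX : v X with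
  | top =>
    refine absurd ⟨hX ▸ le_top, nonneg_of_nonneg_nsmul hq ?_⟩ hXY
    rw [← heq, hX]
    exact nsmul_nonneg le_top _
  | coe a =>
  cases hY : v Y with
  | top =>
    refine absurd ⟨nonneg_of_nonneg_nsmul hp ?_, hY ▸ le_top⟩ hXY
    rw [heq, hY]
    exact nsmul_nonneg le_top _
  | coe b =>
  rw [hX, hY, coe_nsmul_withTop, coe_nsmul_withTop, WithTop.coe_eq_coe] at heq
  have hcop : IsCoprime (q : ℤ) (p : ℤ) := (Nat.isCoprime_iff_coprime.2 hpq).symm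
  obtain ⟨m, rfl⟩ := hcop.dvd_of_dvd_mul_left (Dvd.intro _ heq.symm)
  have hq' : (q : ℤ) ≠ 0 := by exact_mod_cast hq
  obtain rfl : b = p * m := mul_left_cancel₀ hq' (by linarith)
  have hm : m < 0 := by
    by_contra! hm
    refine hXY ⟨?_, ?_⟩
    · rw [hX, ← WithTop.coe_zero, WithTop.coe_le_coe]; positivity
    · rw [hY, ← WithTop.coe_zero, WithTop.coe_le_coe]; positivity
  obtain ⟨k, rfl⟩ : ∃ k : ℕ, m = -k := ⟨(-m).toNat, by omega⟩
  refine ⟨k, by omega, ?_, ?_⟩ <;> congr 1 <;> push_cast <;> ring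

theorem coeff_C_mul_X_add_C_pow (s t : R) (n i : ℕ) :
    ((C s * X + C t) ^ n).coeff i = s ^ i * t ^ (n - i) * n.choose i := by
  have : (C s * X + C t) ^ n = ((X + C t) ^ n).comp (C s * X) := by simp
  rw [this, comp_C_mul_X_coeff, coeff_X_add_C_pow]
  ring

theorem scaling_of_affine_substitution [IsDomain R] [CharZero R] {p q : ℕ} (hp : 2 ≤ p)
    (hq : 2 ≤ q) {c a b r r' : R} {P : R[X]} (hc : c ≠ 0) (ha : a ≠ 0)
    (h : (C (C c) * X + C P) ^ p + C ((C a * X + C b) ^ q) =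
      C (C r) + C (C (c ^ p)) * (X ^ p + C (X ^ q) - C (C r'))) :
    r = c ^ p * r' ∧ r = a ^ q * r' := by
  have hP : P = 0 := by
    have h1 := congrArg (fun F ↦ F.coeff (p - 1)) h
    have hp0 : p - 1 ≠ 0 := by omega
    have hp1 : p - 1 ≠ p := by omega
    have hch : p.choose (p - 1) = p := by
      rw [← Nat.choose_symm_of_eq_add (n := p) (a := 1) (b := p - 1) (by omega),
        Nat.choose_one_right]
    have hpp : p - (p - 1) = 1 := by omega
    simp only [coeff_add, coeff_sub, coeff_C_mul, coeff_X_pow, coeff_C, hp0, hp1, if_false,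
      coeff_C_mul_X_add_C_pow, hch, hpp, pow_one, sub_zero, add_zero, mul_zero] at h1
    have hp' : p ≠ 0 := by omega
    simpa [hc, hp'] using h1
  have h2 : (C a * X + C b) ^ q = C r + C (c ^ p) * (X ^ q - C r') := by
    apply C_injective
    simp only [hP, map_zero, add_zero, mul_pow, map_pow, map_add, map_mul, map_sub] at h ⊢
    linear_combination h
  have hq0 : q ≠ 0 := by omega
  have hb : b = 0 := by
    have h1 := congrArg (fun F ↦ F.coeff (q - 1)) h2
    have hq1 : q - 1 ≠ 0 := by omega
    have hq2 : q - 1 ≠ q := by omega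
    have hch : q.choose (q - 1) = q := by
      rw [← Nat.choose_symm_of_eq_add (n := q) (a := 1) (b := q - 1) (by omega),
        Nat.choose_one_right]
    have hqq : q - (q - 1) = 1 := by omega
    simp only [coeff_add, coeff_sub, coeff_C_mul, coeff_X_pow, coeff_C, hq1, hq2, if_false,
      coeff_C_mul_X_add_C_pow, hch, hqq, pow_one, sub_zero, add_zero, mul_zero] at h1
    simpa [ha, hq0] using h1
  have hac : a ^ q = c ^ p := by
    have h1 := congrArg (fun F ↦ F.coeff q) h2
    simpa [coeff_C_mul_X_add_C_pow, coeff_C, coeff_C_mul, hq0, -map_pow] using h1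
  have hr : r = c ^ p * r' := by
    have h1 := congrArg (fun F ↦ F.coeff 0) h2
    simp only [hb, coeff_C_mul_X_add_C_pow, coeff_add, coeff_C_mul, coeff_sub, coeff_X_pow,
      coeff_C_zero, hq0.symm, if_false, Nat.sub_zero, zero_pow hq0, mul_zero, zero_mul] at h1
    linear_combination -h1
  exact ⟨hr, hac ▸ hr⟩

theorem exists_scaling_of_fermat_curve_points [IsDomain R] [CharZero R]
    (v : AddValuation L (WithTop ℤ)) (f g : R →+* L) (hf : ∀ c, c ≠ 0 → v (f c) = 0)
    (hg : ∀ c, c ≠ 0 → v (g c) = 0) {p q : ℕ} (hp : 2 ≤ p) (hlt : p < q) (hpq : p.Coprime q)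
    {x y x' y' : L} (hx : v x = ((-q : ℤ) : WithTop ℤ)) (hy : v y = ((-p : ℤ) : WithTop ℤ))
    {r r' : R} (hr : r ≠ 0) (hxy : x ^ p + y ^ q = f r') (hxy' : x' ^ p + y' ^ q = f r)
    (hxg : ∃ G : R[X][X], G.natDegree < p ∧ biEval g x' y' G = x)
    (hyg : ∃ G : R[X][X], G.natDegree < p ∧ biEval g x' y' G = y)
    (hxf : ∃ G : R[X][X], G.natDegree < p ∧ biEval f x y G = x')
    (hyf : ∃ G : R[X][X], G.natDegree < p ∧ biEval f x y G = y') :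
    ∃ c a : R, r = c ^ p * r' ∧ r = a ^ q * r' := by
  have hp0 : p ≠ 0 := by omega
  have hq0 : q ≠ 0 := by omega
  have hp' : 0 < p := by omega
  obtain ⟨k, hk, hx', hy'⟩ := v.exists_weights_of_pow_add_pow hp0 hq0 hpq
    (by rw [hxy', hf r hr]) (by
      rintro ⟨h1, h2⟩
      obtain ⟨G, -, hG⟩ := hyg
      have := v.biEval_nonneg g hg h1 h2 G
      rw [hG, hy, ← WithTop.coe_zero, WithTop.coe_le_coe] at this
      omega)
  have ne_zero : ∀ {z : L} {n : ℤ}, v z = (n : WithTop ℤ) → ∀ {h : R →+* L} {s t : L} {G : R[X][X]},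
      biEval h s t G = z → G ≠ 0 := by
    rintro z n hz h s t G rfl rfl
    rw [map_zero, v.map_zero] at hz
    exact WithTop.top_ne_coe hz
  have hkp : k ∣ p := by
    obtain ⟨G, hG, hGy⟩ := hyg
    obtain ⟨i, -, hi, -⟩ := v.exists_map_biEval g hg hk hp' hpq hx' hy' (ne_zero hy hGy) hG
    rw [hGy, hy, WithTop.coe_eq_coe, neg_inj] at hi
    exact Dvd.intro _ (by exact_mod_cast hi.symm)
  have hkq : k ∣ q := by
    obtain ⟨G, hG, hGx⟩ := hxg
    obtain ⟨i, -, hi, -⟩ := v.exists_map_biEval g hg hk hp' hpq hx' hy' (ne_zero hx hGx) hG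
    rw [hGx, hx, WithTop.coe_eq_coe, neg_inj] at hi
    exact Dvd.intro _ (by exact_mod_cast hi.symm)
  obtain rfl : k = 1 := Nat.eq_one_of_dvd_coprimes hpq hkp hkq
  rw [one_mul] at hx' hy'
  have hx1 : v x = ((-(1 * q : ℕ) : ℤ) : WithTop ℤ) := by rw [one_mul]; exact hx
  have hy1 : v y = ((-(1 * p : ℕ) : ℤ) : WithTop ℤ) := by rw [one_mul]; exact hy
  obtain ⟨G, hGp, hG⟩ := hxf
  obtain ⟨H, hHp, hH⟩ := hyf
  have hH' : ∃ a b : R, a ≠ 0 ∧ H = C (C a * X + C b) := by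
    obtain ⟨i, hi1, hi, hmax⟩ := v.exists_map_biEval f hf one_pos hp' hpq hx1 hy1
      (ne_zero hy' hH) hHp
    rw [hH, hy', WithTop.coe_eq_coe, neg_inj, Nat.cast_one, one_mul] at hi
    have hi' : p = q * i + p * (H.coeff i).natDegree := by exact_mod_cast hi
    rw [← hi'] at hmax
    have hcoeff : ∀ j, j ≠ 0 → H.coeff j = 0 := by
      intro j hj
      by_contra hne
      have h1 := hmax j hne
      have h2 : q ≤ q * j := Nat.le_mul_of_pos_right q (Nat.pos_of_ne_zero hj)
      omega
    have hHC : H = C (H.coeff 0) := by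
      ext1 j
      rw [coeff_C]
      split_ifs with hj
      · rw [hj]
      · exact hcoeff j hj
    obtain rfl : i = 0 := by
      by_contra hi0
      have h2 : q ≤ q * i := Nat.le_mul_of_pos_right q (Nat.pos_of_ne_zero hi0)
      omega
    have hdeg : (H.coeff 0).natDegree = 1 := by
      rw [mul_zero, zero_add] at hi'
      exact (Nat.eq_of_mul_eq_mul_left hp' (by rw [mul_one]; exact hi')).symm
    refine ⟨(H.coeff 0).coeff 1, (H.coeff 0).coeff 0, ?_, ?_⟩
    · rw [← hdeg]
      exact leadingCoeff_ne_zero.2 fun h ↦ by simp [h] at hdeg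
    · rw [← eq_X_add_C_of_natDegree_le_one hdeg.le, ← hHC]
  have hG' : ∃ (c : R) (P : R[X]), c ≠ 0 ∧ G = C (C c) * X + C P := by
    obtain ⟨i, hi1, hi, hmax⟩ := v.exists_map_biEval f hf one_pos hp' hpq hx1 hy1
      (ne_zero hx' hG) hGp
    rw [hG, hx', WithTop.coe_eq_coe, neg_inj, Nat.cast_one, one_mul] at hi
    have hi' : q = q * i + p * (G.coeff i).natDegree := by exact_mod_cast hi
    rw [← hi'] at hmax
    have hcoeff : ∀ j, G.coeff j ≠ 0 → j ≤ 1 := by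
      intro j hne
      have h1 := hmax j hne
      by_contra! hj
      have h2 : q * 2 ≤ q * j := Nat.mul_le_mul_left q hj
      omega
    have hi0 : i ≠ 0 := by
      rintro rfl
      rw [mul_zero, zero_add] at hi'
      have : p ∣ q := Dvd.intro _ hi'.symm
      have := Nat.Coprime.eq_one_of_dvd hpq this
      omega
    obtain rfl : i = 1 := by
      have := hcoeff i hi1
      omega
    have hdeg : (G.coeff 1).natDegree = 0 := by
      have h1 := hmax 1 hi1
      rw [mul_one] at h1
      have : p * (G.coeff 1).natDegree = 0 := by omega
      simpa [hp0] using this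
    refine ⟨(G.coeff 1).coeff 0, G.coeff 0, ?_, ?_⟩
    · intro h
      rw [eq_C_of_natDegree_eq_zero hdeg, h, C_0] at hi1
      exact hi1 rfl
    · rw [← eq_C_of_natDegree_eq_zero hdeg]
      refine eq_X_add_C_of_natDegree_le_one (natDegree_le_iff_coeff_eq_zero.2 fun j hj ↦ ?_)
      by_contra hne
      exact absurd (hcoeff j hne) (by omega)
  obtain ⟨a, b, ha, rfl⟩ := hH'
  obtain ⟨c, P, hc, rfl⟩ := hG'
  refine ⟨c, a, scaling_of_affine_substitution hp (by omega) (b := b) (P := P) hc ha ?_⟩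
  set F : R[X][X] := (C (C c) * X + C P) ^ p - C (C (c ^ p)) * X ^ p +
    C ((C a * X + C b) ^ q - C r - C (c ^ p) * (X ^ q - C r')) with hF
  have hFdeg : F.natDegree < p := by
    refine lt_of_le_of_lt (natDegree_le_iff_coeff_eq_zero.2 fun N hN ↦ ?_) (Nat.sub_one_lt hp0)
    have hN0 : N ≠ 0 := by omega
    rw [hF, coeff_add, coeff_sub, coeff_C_mul_X_add_C_pow, coeff_C_mul, coeff_X_pow, coeff_C,
      if_neg hN0, add_zero]
    rcases eq_or_ne N p with rfl | hNp
    · simp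
    · rw [Nat.choose_eq_zero_of_lt (by omega), if_neg hNp]
      simp
  have hF0 : F = 0 := by
    by_contra hne
    obtain ⟨i, -, hi, -⟩ := v.exists_map_biEval f hf one_pos hp' hpq hx1 hy1 hne hFdeg
    refine WithTop.top_ne_coe (Eq.trans ?_ hi)
    rw [← v.map_zero]
    congr 1
    have e1 : ∀ s : R, biEval f x y (C (C s)) = f s := fun s ↦ by simp [biEval]
    have e2 : biEval f x y X = x := by simp [biEval]
    have e3 : biEval f x y (C X) = y := by simp [biEval]
    simp only [map_add, map_mul, e1, e2, e3] at hG hH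
    simp only [hF, map_sub, map_add, map_mul, map_pow, e1, e2, e3]
    rw [hG, hH]
    linear_combination f c ^ p * hxy - hxy'
  simp only [hF, map_sub, map_add, map_mul, map_pow] at hF0 ⊢
  linear_combination hF0

end Scaling

end

namespace LaurentPolynomial

theorem ringHom_ext_of_C_T {R S : Type*} [CommRing R] [CommRing S] {f g : LaurentPolynomial R →+* S}
    (hC : ∀ r, f (C r) = g (C r)) (hT : f (T 1) = g (T 1)) : f = g := by
  refine IsLocalization.ringHom_ext (Submonoid.powers (Polynomial.X : Polynomial R)) ?_
  refine Polynomial.ringHom_ext (fun r ↦ ?_) ?_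
  · simpa [algebraMap_eq_toLaurent] using hC r
  · simpa [algebraMap_eq_toLaurent] using hT

theorem eq_of_C_mul_T_eq {R : Type*} [CommRing R] {a b : R} {m n : ℤ} (ha : a ≠ 0)
    (h : C a * T m = C b * T n) : m = n := by
  by_contra hmn
  have := congrArg (fun F ↦ F.coeff m) h
  simp only [← single_eq_C_mul_T, AddMonoidAlgebra.coeff_single] at this
  simp [Ne.symm hmn, ha] at this

theorem exists_eq_C_mul_T_of_isUnit_s6 {K : Type*} [Field K] {u : LaurentPolynomial K}
    (hu : IsUnit u) : ∃ (a : K) (n : ℤ), a ≠ 0 ∧ u = C a * T n := by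
  obtain ⟨w, hw⟩ := hu.exists_right_inv
  obtain ⟨m, F, hF⟩ := exists_T_pow u
  obtain ⟨n, G, hG⟩ := exists_T_pow w
  have hFG : F * G = Polynomial.X ^ (m + n) := by
    apply Polynomial.toLaurent_injective
    rw [map_mul, hF, hG, Polynomial.toLaurent_X_pow, Nat.cast_add, T_add]
    linear_combination (T (m : ℤ) * T (n : ℤ) : LaurentPolynomial K) * hw
  obtain ⟨i, -, hi⟩ := (dvd_prime_pow Polynomial.prime_X _).1 (Dvd.intro _ hFG)
  obtain ⟨e, he⟩ := hi.symm
  obtain ⟨a, ha, hae⟩ := Polynomial.isUnit_iff.1 e.isUnit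
  refine ⟨a, i - m, ha.ne_zero, ?_⟩
  rw [← hae] at he
  have : u = u * T m * T (-m) := by rw [mul_T_assoc, add_neg_cancel, T_zero, mul_one]
  rw [this, ← hF, ← he, map_mul, Polynomial.toLaurent_X_pow, Polynomial.toLaurent_C, T_sub]
  ring

end LaurentPolynomial

theorem biEval_comp {R L M : Type*} [CommRing R] [CommRing L] [CommRing M] (f : R →+* L)
    (h : L →+* M) (x y : L) (G : Polynomial (Polynomial R)) :
    h (biEval f x y G) = biEval (h.comp f) (h x) (h y) G := by
  refine RingHom.congr_fun (f := h.comp (biEval f x y)) (g := biEval (h.comp f) (h x) (h y)) ?_ G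
  refine Polynomial.ringHom_ext' (Polynomial.ringHom_ext (fun r ↦ ?_) ?_) ?_ <;> simp [biEval]

theorem HahnSeries.addVal_C {R : Type*} [CommRing R] [IsDomain R] {c : R} (hc : c ≠ 0) :
    HahnSeries.addVal ℤ R (HahnSeries.C c) = 0 := by
  exact HahnSeries.addVal_apply.trans (HahnSeries.orderTop_single hc)

namespace surfaceRingPQ

open LaurentPolynomial

variable {p q ℓ : ℕ}

/-- The class of a coordinate function in the coordinate ring. -/
noncomputable def coord (p q ℓ : ℕ) (i : Fin 3) : surfaceRingPQ p q ℓ :=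
  Ideal.Quotient.mk _ (MvPolynomial.X i)

theorem relation (p q ℓ : ℕ) :
    coord p q ℓ 2 ^ ℓ * (coord p q ℓ 0 ^ p + coord p q ℓ 1 ^ q) = 1 := by
  rw [← sub_eq_zero]
  simp only [coord, ← map_pow, ← map_add, ← map_mul]
  rw [← map_one (Ideal.Quotient.mk _), ← map_sub, Ideal.Quotient.eq_zero_iff_mem]
  exact Ideal.subset_span rfl

section Lift

variable {B : Type*} [CommRing B] [Algebra ℂ B]

/-- The homomorphism out of the coordinate ring given by a point of the surface. -/
noncomputable def lift (x y t : B) (h : t ^ ℓ * (x ^ p + y ^ q) = 1) :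
    surfaceRingPQ p q ℓ →ₐ[ℂ] B :=
  Ideal.Quotient.liftₐ _ (MvPolynomial.aeval ![x, y, t]) (by
    intro a ha
    rw [← RingHom.mem_ker]
    revert a
    change _ ≤ RingHom.ker (MvPolynomial.aeval (R := ℂ) ![x, y, t])
    rw [Ideal.span_le, Set.singleton_subset_iff, SetLike.mem_coe, RingHom.mem_ker]
    simp [h])

variable {x y t : B} {h : t ^ ℓ * (x ^ p + y ^ q) = 1}

@[simp] theorem lift_coord_zero : lift x y t h (coord p q ℓ 0) = x := by
  change MvPolynomial.aeval ![x, y, t] (MvPolynomial.X 0) = x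
  simp

@[simp] theorem lift_coord_one : lift x y t h (coord p q ℓ 1) = y := by
  change MvPolynomial.aeval ![x, y, t] (MvPolynomial.X 1) = y
  simp

@[simp] theorem lift_coord_two : lift x y t h (coord p q ℓ 2) = t := by
  change MvPolynomial.aeval ![x, y, t] (MvPolynomial.X 2) = t
  simp

theorem algHom_ext {f g : surfaceRingPQ p q ℓ →ₐ[ℂ] B}
    (h0 : f (coord p q ℓ 0) = g (coord p q ℓ 0)) (h1 : f (coord p q ℓ 1) = g (coord p q ℓ 1))
    (h2 : f (coord p q ℓ 2) = g (coord p q ℓ 2)) : f = g := by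
  refine Ideal.Quotient.algHom_ext _ (MvPolynomial.algHom_ext fun i ↦ ?_)
  fin_cases i
  exacts [h0, h1, h2]

end Lift

theorem isUnit_coord_two (hℓ : ℓ ≠ 0) : IsUnit (coord p q ℓ 2) :=
  (isUnit_pow_iff hℓ).1 (IsUnit.of_mul_eq_one _ (relation p q ℓ))

/-- The coordinate `t` as a unit. -/
noncomputable def unitT (p q : ℕ) {ℓ : ℕ} (hℓ : ℓ ≠ 0) : (surfaceRingPQ p q ℓ)ˣ :=
  (isUnit_coord_two hℓ).unit

@[simp] theorem val_unitT (hℓ : ℓ ≠ 0) : (unitT p q hℓ : surfaceRingPQ p q ℓ) = coord p q ℓ 2 :=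
  IsUnit.unit_spec _

/-- The structure of an algebra over the ring of Laurent polynomials in `t`. -/
noncomputable def ofLaurent (p q : ℕ) {ℓ : ℕ} (hℓ : ℓ ≠ 0) :
    LaurentPolynomial ℂ →+* surfaceRingPQ p q ℓ :=
  eval₂ (algebraMap ℂ _) (unitT p q hℓ)

@[simp] theorem ofLaurent_C (hℓ : ℓ ≠ 0) (a : ℂ) :
    ofLaurent p q hℓ (C a) = algebraMap ℂ (surfaceRingPQ p q ℓ) a :=
  eval₂_C _ _ a

theorem ofLaurent_T (hℓ : ℓ ≠ 0) (n : ℤ) :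
    ofLaurent p q hℓ (T n) = ((unitT p q hℓ ^ n : (surfaceRingPQ p q ℓ)ˣ) : surfaceRingPQ p q ℓ) :=
  eval₂_T _ _ n

@[simp] theorem ofLaurent_T_one (hℓ : ℓ ≠ 0) : ofLaurent p q hℓ (T 1) = coord p q ℓ 2 := by
  rw [ofLaurent_T, zpow_one, val_unitT]

theorem pow_add_pow (hℓ : ℓ ≠ 0) :
    coord p q ℓ 0 ^ p + coord p q ℓ 1 ^ q = ofLaurent p q hℓ (T (-ℓ)) := by
  have h1 : ofLaurent p q hℓ (T (-ℓ)) * coord p q ℓ 2 ^ ℓ = 1 := by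
    rw [← ofLaurent_T_one hℓ, ← map_pow, ← map_mul, T_pow, ← T_add, mul_one, neg_add_cancel,
      T_zero, map_one]
  linear_combination ofLaurent p q hℓ (T (-ℓ)) * relation p q ℓ -
    (coord p q ℓ 0 ^ p + coord p q ℓ 1 ^ q) * h1

theorem exists_biEval_eq (hℓ : ℓ ≠ 0) (hp : p ≠ 0) (a : surfaceRingPQ p q ℓ) :
    ∃ G : Polynomial (Polynomial (LaurentPolynomial ℂ)), G.natDegree < p ∧
      biEval (ofLaurent p q hℓ) (coord p q ℓ 0) (coord p q ℓ 1) G = a := by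
  set ev := biEval (ofLaurent p q hℓ) (coord p q ℓ 0) (coord p q ℓ 1) with hev
  have evX : ev Polynomial.X = coord p q ℓ 0 := by simp [hev, biEval]
  have evY : ev (Polynomial.C Polynomial.X) = coord p q ℓ 1 := by simp [hev, biEval]
  have evC : ∀ r, ev (Polynomial.C (Polynomial.C r)) = ofLaurent p q hℓ r := fun r ↦ by
    simp [hev, biEval]
  obtain ⟨F, rfl⟩ : ∃ F, ev F = a := by
    obtain ⟨m, rfl⟩ := Ideal.Quotient.mk_surjective a
    induction m using MvPolynomial.induction_on with
    | C c =>
      refine ⟨Polynomial.C (Polynomial.C (C c)), ?_⟩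
      rw [evC, ofLaurent_C]
      rfl
    | add f g hf hg =>
      obtain ⟨F, hF⟩ := hf
      obtain ⟨G, hG⟩ := hg
      exact ⟨F + G, by rw [map_add, hF, hG, map_add]⟩
    | mul_X f i hf =>
      obtain ⟨F, hF⟩ := hf
      obtain ⟨G, hG⟩ : ∃ G, ev G = coord p q ℓ i := by
        fin_cases i
        exacts [⟨_, evX⟩, ⟨_, evY⟩, ⟨_, (evC (T 1)).trans (ofLaurent_T_one hℓ)⟩]
      exact ⟨F * G, by rw [map_mul, hF, hG, map_mul]; rfl⟩
  set M : Polynomial (Polynomial (LaurentPolynomial ℂ)) :=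
    Polynomial.X ^ p - Polynomial.C (Polynomial.C (T (-ℓ)) - Polynomial.X ^ q) with hM
  have hMm : M.Monic := Polynomial.monic_X_pow_sub_C _ hp
  have hMev : ev M = 0 := by
    rw [hM, map_sub, map_pow, evX, map_sub, map_sub, evC, ← pow_add_pow, map_pow, map_pow, evY]
    ring
  refine ⟨F %ₘ M, ?_, ?_⟩
  · have hMd : M.natDegree = p := Polynomial.natDegree_X_pow_sub_C
    rw [← hMd]
    refine Polynomial.natDegree_modByMonic_lt _ hMm fun h1 ↦ hp ?_
    rw [← hMd, h1, Polynomial.natDegree_one]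
  · conv_rhs => rw [← Polynomial.modByMonic_add_div F M, map_add, map_mul, hMev, zero_mul, add_zero]

/-- A parametrization of the surface near infinity by Laurent series. -/
theorem exists_parametrization (hp : p ≠ 0) (hq : q ≠ 0) (hℓ : ℓ ≠ 0) :
    ∃ Φ : surfaceRingPQ p q ℓ →+* HahnSeries ℤ (LaurentPolynomial ℂ),
      Φ.comp (ofLaurent p q hℓ) = HahnSeries.C ∧
      HahnSeries.addVal ℤ _ (Φ (coord p q ℓ 0)) = ((-q : ℤ) : WithTop ℤ) ∧
      HahnSeries.addVal ℤ _ (Φ (coord p q ℓ 1)) = ((-p : ℤ) : WithTop ℤ) := by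
  obtain ⟨x, y, hxy, hx, hy⟩ :=
    LaurentSeries.exists_fermat_curve_point (T (-ℓ) : LaurentPolynomial ℂ) hp hq
  let Φ : surfaceRingPQ p q ℓ →ₐ[ℂ] HahnSeries ℤ (LaurentPolynomial ℂ) :=
    lift x y (HahnSeries.C (T 1)) (by
      rw [hxy, ← map_pow, ← map_mul, T_pow, ← T_add, mul_one, add_neg_cancel, T_zero, map_one])
  refine ⟨Φ, ringHom_ext_of_C_T (fun r ↦ ?_) ?_, ?_, ?_⟩
  · rw [RingHom.comp_apply, ofLaurent_C, RingHom.coe_coe, AlgHom.commutes,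
      HahnSeries.algebraMap_apply', PowerSeries.algebraMap_apply, HahnSeries.ofPowerSeries_C,
      LaurentPolynomial.algebraMap_apply, Algebra.algebraMap_self_apply]
  · rw [RingHom.comp_apply, ofLaurent_T_one, RingHom.coe_coe, lift_coord_two]
  · rw [RingHom.coe_coe, lift_coord_zero, hx]
  · rw [RingHom.coe_coe, lift_coord_one, hy]

section Parametrization

variable {hℓ : ℓ ≠ 0} {Φ : surfaceRingPQ p q ℓ →+* HahnSeries ℤ (LaurentPolynomial ℂ)}

theorem exists_biEval_eq_map
    (hΦ : Φ.comp (ofLaurent p q hℓ) = HahnSeries.C)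
    (hΦx : HahnSeries.addVal ℤ _ (Φ (coord p q ℓ 0)) = ((-q : ℤ) : WithTop ℤ))
    (hΦy : HahnSeries.addVal ℤ _ (Φ (coord p q ℓ 1)) = ((-p : ℤ) : WithTop ℤ))
    (hp : p ≠ 0) (hpq : p.Coprime q) {a : surfaceRingPQ p q ℓ}
    (ha : a ≠ 0) : ∃ (G : Polynomial (Polynomial (LaurentPolynomial ℂ))) (i : ℕ),
      biEval (ofLaurent p q hℓ) (coord p q ℓ 0) (coord p q ℓ 1) G = a ∧
      HahnSeries.addVal ℤ _ (Φ a) =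
        ((-(q * i + p * (G.coeff i).natDegree : ℕ) : ℤ) : WithTop ℤ) ∧
      ∀ j, G.coeff j ≠ 0 →
        q * j + p * (G.coeff j).natDegree ≤ q * i + p * (G.coeff i).natDegree := by
  obtain ⟨G, hGp, rfl⟩ := exists_biEval_eq hℓ hp a
  have hG : G ≠ 0 := by
    rintro rfl
    exact ha (map_zero _)
  obtain ⟨i, -, h1, h2⟩ := AddValuation.exists_map_biEval _ (HahnSeries.C)
    (fun _ ↦ HahnSeries.addVal_C) one_pos (Nat.pos_of_ne_zero hp) hpq
    (by rw [one_mul]; exact hΦx) (by rw [one_mul]; exact hΦy) hG hGp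
  refine ⟨G, i, rfl, ?_, h2⟩
  rw [biEval_comp, hΦ, h1]
  congr 1
  push_cast
  ring

theorem exists_ofLaurent_eq_of_isUnit
    (hΦ : Φ.comp (ofLaurent p q hℓ) = HahnSeries.C)
    (hΦx : HahnSeries.addVal ℤ _ (Φ (coord p q ℓ 0)) = ((-q : ℤ) : WithTop ℤ))
    (hΦy : HahnSeries.addVal ℤ _ (Φ (coord p q ℓ 1)) = ((-p : ℤ) : WithTop ℤ))
    (hp : p ≠ 0) (hq : q ≠ 0) (hpq : p.Coprime q)
    {u : surfaceRingPQ p q ℓ} (hu : IsUnit u) :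
    ∃ (a : ℂ) (n : ℤ), a ≠ 0 ∧ u = ofLaurent p q hℓ (C a * T n) := by
  have : Nontrivial (surfaceRingPQ p q ℓ) := Φ.domain_nontrivial
  have key : ∀ a b : surfaceRingPQ p q ℓ, a * b = 1 → ∃ r, a = ofLaurent p q hℓ r := by
    intro a b hab
    obtain ⟨G, i, hG, hGv, hmax⟩ :=
      exists_biEval_eq_map hΦ hΦx hΦy hp hpq (left_ne_zero_of_mul_eq_one hab)
    obtain ⟨H, j, hH, hHv, -⟩ :=
      exists_biEval_eq_map hΦ hΦx hΦy hp hpq (right_ne_zero_of_mul_eq_one hab)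
    have h0 := congrArg (HahnSeries.addVal ℤ (LaurentPolynomial ℂ)) (congrArg Φ hab)
    rw [map_mul, AddValuation.map_mul, hGv, hHv, map_one, AddValuation.map_one, ← WithTop.coe_add,
      ← WithTop.coe_zero, WithTop.coe_eq_coe] at h0
    have hi : q * i + p * (G.coeff i).natDegree = 0 := by omega
    rw [hi] at hmax
    have hG0 : ∀ k, k ≠ 0 → G.coeff k = 0 := by
      intro k hk
      by_contra hne
      have := hmax k hne
      have : 0 < q * k := Nat.mul_pos (Nat.pos_of_ne_zero hq) (Nat.pos_of_ne_zero hk)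
      omega
    have hGd : G.natDegree = 0 :=
      Nat.le_zero.1 (Polynomial.natDegree_le_iff_coeff_eq_zero.2 fun k hk ↦ hG0 k hk.ne')
    have hGd0 : (G.coeff 0).natDegree = 0 := by
      by_cases hne : G.coeff 0 = 0
      · rw [hne, Polynomial.natDegree_zero]
      · have := hmax 0 hne
        have : p * (G.coeff 0).natDegree = 0 := by omega
        simpa [hp] using this
    refine ⟨(G.coeff 0).coeff 0, ?_⟩
    rw [← hG]
    conv_lhs => rw [Polynomial.eq_C_of_natDegree_eq_zero hGd,
      Polynomial.eq_C_of_natDegree_eq_zero hGd0]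
    simp [biEval]
  obtain ⟨w, hw⟩ := hu.exists_right_inv
  obtain ⟨r, hr⟩ := key u w hw
  obtain ⟨s, hs⟩ := key w u (by rw [mul_comm]; exact hw)
  have hrs : r * s = 1 := by
    apply HahnSeries.C_injective (Γ := ℤ)
    rw [← hΦ, RingHom.comp_apply, map_mul, ← hr, ← hs, hw, map_one, map_one]
  obtain ⟨a, n, ha, rfl⟩ := exists_eq_C_mul_T_of_isUnit_s6 (IsUnit.of_mul_eq_one _ hrs)
  exact ⟨a, n, ha, hr⟩

end Parametrization

theorem _root_.LaurentPolynomial.exists_unit_zpow_eq {K : Type*} [Field K] {a : K} (ha : a ≠ 0)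
    (n : ℤ) : ∃ U : (LaurentPolynomial K)ˣ, ∀ m : ℤ,
      ((U ^ m : (LaurentPolynomial K)ˣ) : LaurentPolynomial K) = C (a ^ m) * T (n * m) := by
  have inv : ∀ (b : K) (k : ℤ), b ≠ 0 → (C b * T k) * (C b⁻¹ * T (-k)) = 1 := by
    intro b k hb
    rw [mul_mul_mul_comm, ← map_mul, ← T_add, mul_inv_cancel₀ hb, add_neg_cancel, map_one, T_zero,
      mul_one]
  refine ⟨⟨C a * T n, C a⁻¹ * T (-n), inv a n ha, by rw [mul_comm, inv a n ha]⟩, fun m ↦ ?_⟩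
  cases m with
  | ofNat m =>
    rw [Int.ofNat_eq_natCast, zpow_natCast, zpow_natCast, Units.val_pow_eq_pow_val, mul_pow, T_pow,
      ← map_pow C, mul_comm n]
  | negSucc m =>
    rw [zpow_negSucc, zpow_negSucc, Units.inv_eq_of_mul_eq_one_right]
    rw [Units.val_pow_eq_pow_val]
    have h : n * Int.negSucc m = -(((m + 1 : ℕ) : ℤ) * n) := by
      rw [Int.negSucc_eq]
      push_cast
      ring
    rw [mul_pow, T_pow, ← map_pow C, h]
    exact inv _ _ (pow_ne_zero _ ha)

theorem _root_.LaurentPolynomial.dvd_add_one_of_eq_pow_mul {K : Type*} [Field K] {a : K}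
    (ha : a ≠ 0) {k : ℤ} {m : ℕ} (hm : m ≠ 0) {c : LaurentPolynomial K}
    (h : C a * T k = c ^ m * T (-1)) : (m : ℤ) ∣ k + 1 := by
  have hc : c ^ m = C a * T (k + 1) := by
    rw [T_add, ← mul_assoc, h, mul_assoc, ← T_add, neg_add_cancel, T_zero, mul_one]
  have hu : IsUnit (c ^ m) := by
    rw [hc]
    exact (ha.isUnit.map C).mul (isUnit_T _)
  obtain ⟨b, n, -, rfl⟩ := exists_eq_C_mul_T_of_isUnit_s6 ((isUnit_pow_iff hm).1 hu)
  rw [mul_pow, T_pow, ← map_pow] at hc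
  exact Dvd.intro _ (eq_of_C_mul_T_eq ha hc.symm).symm

theorem exists_dvd_one_sub_of_algEquiv (hp : 2 ≤ p) (hlt : p < q) (hpq : p.Coprime q) (hℓ : ℓ ≠ 0)
    (φ : surfaceRingPQ p q ℓ ≃ₐ[ℂ] surfaceRingPQ p q 1) :
    ∃ n : ℤ, (n = 1 ∨ n = -1) ∧ ((p * q : ℕ) : ℤ) ∣ 1 - n * ℓ := by
  have hp0 : p ≠ 0 := by omega
  have hq0 : q ≠ 0 := by omega
  obtain ⟨Φ, hΦ, hΦx, hΦy⟩ := exists_parametrization hp0 hq0 hℓ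
  obtain ⟨Ψ, hΨ, hΨx, hΨy⟩ := exists_parametrization hp0 hq0 one_ne_zero
  have inj : Function.Injective (ofLaurent p q hℓ) := by
    refine Function.Injective.of_comp (f := Φ) ?_
    rw [← RingHom.coe_comp, hΦ]
    exact HahnSeries.C_injective
  have inj₁ : Function.Injective (ofLaurent p q one_ne_zero) := by
    refine Function.Injective.of_comp (f := Ψ) ?_
    rw [← RingHom.coe_comp, hΨ]
    exact HahnSeries.C_injective
  obtain ⟨a, n, ha, hn⟩ := exists_ofLaurent_eq_of_isUnit hΨ hΨx hΨy hp0 hq0 hpq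
    ((isUnit_coord_two hℓ).map φ)
  obtain ⟨b, m, hb, hm⟩ := exists_ofLaurent_eq_of_isUnit hΦ hΦx hΦy hp0 hq0 hpq
    ((isUnit_coord_two one_ne_zero).map φ.symm)
  obtain ⟨U, hU⟩ := exists_unit_zpow_eq ha n
  set θ : LaurentPolynomial ℂ →+* LaurentPolynomial ℂ := eval₂ C U with hθ
  have hθCT : ∀ (e : ℂ) (k : ℤ), θ (C e * T k) = C (e * a ^ k) * T (n * k) := fun e k ↦ by
    rw [hθ, map_mul, eval₂_C, eval₂_T, hU, map_mul, mul_assoc]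
  have hφθ : (φ : surfaceRingPQ p q ℓ →+* surfaceRingPQ p q 1).comp (ofLaurent p q hℓ) =
      (ofLaurent p q one_ne_zero).comp θ := by
    refine ringHom_ext_of_C_T (fun e ↦ ?_) ?_
    · simp [hθ]
    · have := hU 1
      rw [zpow_one, zpow_one, mul_one] at this
      simp [hθ, hn, this]
  have hφθ' : ∀ s, φ (ofLaurent p q hℓ s) = ofLaurent p q one_ne_zero (θ s) :=
    fun s ↦ RingHom.congr_fun hφθ s
  have hnm : n = 1 ∨ n = -1 := by
    have h1 : θ (C b * T m) = T 1 := by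
      apply inj₁
      rw [← hφθ', ← hm, AlgEquiv.apply_symm_apply, ofLaurent_T_one]
    rw [hθCT, ← one_mul (T 1), ← map_one C] at h1
    exact Int.eq_one_or_neg_one_of_mul_eq_one
      (eq_of_C_mul_T_eq (mul_ne_zero hb (zpow_ne_zero _ ha)) h1)
  have hθinj : Function.Injective θ := by
    refine Function.Injective.of_comp (f := ofLaurent p q one_ne_zero) ?_
    rw [← RingHom.coe_comp, ← hφθ]
    exact φ.injective.comp inj
  have hΨφ : (Ψ.comp (φ : surfaceRingPQ p q ℓ →+* surfaceRingPQ p q 1)).comp (ofLaurent p q hℓ) =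
      HahnSeries.C.comp θ := by
    rw [RingHom.comp_assoc, hφθ, ← RingHom.comp_assoc, hΨ]
  have hg : ∀ w, ∃ G : Polynomial (Polynomial (LaurentPolynomial ℂ)), G.natDegree < p ∧
      biEval (HahnSeries.C.comp θ) (Ψ (φ (coord p q ℓ 0))) (Ψ (φ (coord p q ℓ 1))) G = Ψ w := by
    intro w
    obtain ⟨G, hG, h⟩ := exists_biEval_eq hℓ hp0 (φ.symm w)
    refine ⟨G, hG, ?_⟩
    rw [← hΨφ]
    refine (biEval_comp _ _ _ _ _).symm.trans ?_
    rw [h]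
    exact congrArg Ψ (φ.apply_symm_apply w)
  have hf : ∀ w, ∃ G : Polynomial (Polynomial (LaurentPolynomial ℂ)), G.natDegree < p ∧
      biEval HahnSeries.C (Ψ (coord p q 1 0)) (Ψ (coord p q 1 1)) G = Ψ w := by
    intro w
    obtain ⟨G, hG, h⟩ := exists_biEval_eq one_ne_zero hp0 w
    exact ⟨G, hG, by rw [← hΨ, ← biEval_comp, h]⟩
  have hr : θ (T (-ℓ)) = C (a ^ (-ℓ : ℤ)) * T (n * -ℓ) := by
    rw [← one_mul (T (-ℓ)), ← map_one C, hθCT, one_mul]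
  have hr0 : a ^ (-ℓ : ℤ) ≠ 0 := zpow_ne_zero _ ha
  have : CharZero (LaurentPolynomial ℂ) := algebraRat.charZero _
  obtain ⟨c, d, hc, hd⟩ := exists_scaling_of_fermat_curve_points (HahnSeries.addVal ℤ _)
    HahnSeries.C (HahnSeries.C.comp θ) (fun _ ↦ HahnSeries.addVal_C)
    (fun e he ↦ HahnSeries.addVal_C ((map_ne_zero_iff θ hθinj).2 he)) hp hlt hpq hΨx hΨy
    (x' := Ψ (φ (coord p q ℓ 0))) (y' := Ψ (φ (coord p q ℓ 1)))
    (r := θ (T (-ℓ))) (r' := T (-1)) ((map_ne_zero_iff θ hθinj).2 (isUnit_T _).ne_zero)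
    (by rw [← map_pow, ← map_pow, ← map_add, pow_add_pow one_ne_zero, Nat.cast_one,
      ← RingHom.comp_apply, hΨ])
    (by rw [← map_pow Ψ, ← map_pow Ψ, ← map_add, ← map_pow, ← map_pow, ← map_add, pow_add_pow hℓ,
      hφθ', ← RingHom.comp_apply, hΨ])
    (hg _) (hg _) (hf _) (hf _)
  rw [hr] at hc hd
  refine ⟨n, hnm, ?_⟩
  have h := (Int.isCoprime_iff_gcd_eq_one.2 (by simpa using hpq)).mul_dvd
    (dvd_add_one_of_eq_pow_mul hr0 hp0 hc) (dvd_add_one_of_eq_pow_mul hr0 hq0 hd)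
  rw [Nat.cast_mul]
  rwa [show 1 - n * (ℓ : ℤ) = n * -ℓ + 1 by ring]

/-- Interchanging the two exponents. -/
noncomputable def swap (p q ℓ : ℕ) : surfaceRingPQ p q ℓ ≃ₐ[ℂ] surfaceRingPQ q p ℓ :=
  AlgEquiv.ofAlgHom
    (lift (coord q p ℓ 1) (coord q p ℓ 0) (coord q p ℓ 2) (by linear_combination relation q p ℓ))
    (lift (coord p q ℓ 1) (coord p q ℓ 0) (coord p q ℓ 2) (by linear_combination relation p q ℓ))
    (algHom_ext (by simp) (by simp) (by simp)) (algHom_ext (by simp) (by simp) (by simp))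

theorem modEq_one_or_neg_one_of_algEquiv (hp : 2 ≤ p) (hq : 2 ≤ q) (hpq : p.Coprime q)
    (hℓ : ℓ ≠ 0) (φ : surfaceRingPQ p q ℓ ≃ₐ[ℂ] surfaceRingPQ p q 1) :
    (ℓ : ℤ) ≡ 1 [ZMOD (p * q : ℕ)] ∨ (ℓ : ℤ) ≡ -1 [ZMOD (p * q : ℕ)] := by
  obtain ⟨n, hn, h⟩ : ∃ n : ℤ, (n = 1 ∨ n = -1) ∧ ((p * q : ℕ) : ℤ) ∣ 1 - n * ℓ := by
    rcases lt_trichotomy p q with hlt | rfl | hlt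
    · exact exists_dvd_one_sub_of_algEquiv hp hlt hpq hℓ φ
    · rw [Nat.coprime_self] at hpq
      omega
    · rw [mul_comm p]
      exact exists_dvd_one_sub_of_algEquiv hq hlt hpq.symm hℓ
        ((swap q p ℓ).trans (φ.trans (swap p q 1)))
  rcases hn with rfl | rfl
  · exact Or.inl (Int.modEq_iff_dvd.2 (by simpa using h))
  · refine Or.inr (Int.modEq_iff_dvd.2 ?_)
    rw [show (-1 - ℓ : ℤ) = -(1 - -1 * ℓ) by ring]
    exact dvd_neg.2 h

section Laurent

variable {B : Type*} [CommRing B] [Algebra ℂ B]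

/-- The homomorphism out of the coordinate ring of a cylinder given by a point of the cylinder. -/
noncomputable def laurentLift (x y : B) (t u : Bˣ) (h : (t : B) ^ ℓ * (x ^ p + y ^ q) = 1) :
    LaurentPolynomial (surfaceRingPQ p q ℓ) →ₐ[ℂ] B :=
  { eval₂ (lift x y t h : surfaceRingPQ p q ℓ →+* B) u with
    commutes' := fun r ↦ by
      change eval₂ (lift x y t h : surfaceRingPQ p q ℓ →+* B) u (algebraMap _ _ r) = _
      rw [LaurentPolynomial.algebraMap_apply, eval₂_C]
      exact (lift x y (t : B) h : surfaceRingPQ p q ℓ →ₐ[ℂ] B).commutes r }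

variable {x y : B} {t u : Bˣ} {h : (t : B) ^ ℓ * (x ^ p + y ^ q) = 1}

@[simp] theorem laurentLift_C (a : surfaceRingPQ p q ℓ) :
    laurentLift x y t u h (C a) = lift x y t h a :=
  eval₂_C _ _ a

@[simp] theorem laurentLift_T (n : ℤ) :
    laurentLift x y t u h (T n) = ((u ^ n : Bˣ) : B) :=
  eval₂_T _ _ n

theorem laurent_algHom_ext {f g : LaurentPolynomial (surfaceRingPQ p q ℓ) →ₐ[ℂ] B}
    (h0 : f (C (coord p q ℓ 0)) = g (C (coord p q ℓ 0)))
    (h1 : f (C (coord p q ℓ 1)) = g (C (coord p q ℓ 1)))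
    (h2 : f (C (coord p q ℓ 2)) = g (C (coord p q ℓ 2))) (h3 : f (T 1) = g (T 1)) : f = g := by
  let ι : surfaceRingPQ p q ℓ →ₐ[ℂ] LaurentPolynomial (surfaceRingPQ p q ℓ) :=
    { C with commutes' := fun r ↦ (LaurentPolynomial.algebraMap_apply r).symm }
  have key : f.comp ι = g.comp ι := algHom_ext h0 h1 h2
  have : (f : LaurentPolynomial (surfaceRingPQ p q ℓ) →+* B) = g :=
    ringHom_ext_of_C_T (fun a ↦ AlgHom.congr_fun key a) h3
  exact AlgHom.coe_ringHom_injective this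

end Laurent

theorem _root_.zpow_mul_zpow_mul_zpow_mul_zpow {G : Type*} [CommGroup G] (s t : G)
    (a b c d m n : ℤ) :
    (s ^ a * t ^ b) ^ m * (s ^ c * t ^ d) ^ n = s ^ (a * m + c * n) * t ^ (b * m + d * n) := by
  rw [mul_zpow, mul_zpow, zpow_add, zpow_add, ← zpow_mul, ← zpow_mul, ← zpow_mul, ← zpow_mul]
  exact mul_mul_mul_comm _ _ _ _

theorem _root_.RingHom.map_units_zpow_mul_zpow {A B : Type*} [CommRing A] [CommRing B] (f : A →+* B)
    {s t : Aˣ} {s' t' : Bˣ} (hs : f s = s') (ht : f t = t') (a b : ℤ) :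
    f ((s ^ a * t ^ b : Aˣ) : A) = ((s' ^ a * t' ^ b : Bˣ) : B) := by
  obtain rfl : Units.map (f : A →* B) s = s' := Units.ext hs
  obtain rfl : Units.map (f : A →* B) t = t' := Units.ext ht
  rw [← map_zpow, ← map_zpow, ← map_mul]
  rfl

theorem relation_of_scaling {B : Type*} [CommRing B] {x y : B} {s : Bˣ}
    (h : (s : B) * (x ^ p + y ^ q) = 1) (u : Bˣ) :
    ((s * u ^ (-(p * q : ℤ)) : Bˣ) : B) *
      ((x * (u ^ (q : ℤ) : Bˣ)) ^ p + (y * (u ^ (p : ℤ) : Bˣ)) ^ q) = 1 := by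
  have h1 : (((u ^ (q : ℤ) : Bˣ) : B)) ^ p = ((u ^ (p * q : ℤ) : Bˣ) : B) := by
    rw [← Units.val_pow_eq_pow_val, ← zpow_natCast, ← zpow_mul, mul_comm]
  have h2 : (((u ^ (p : ℤ) : Bˣ) : B)) ^ q = ((u ^ (p * q : ℤ) : Bˣ) : B) := by
    rw [← Units.val_pow_eq_pow_val, ← zpow_natCast, ← zpow_mul]
  have h3 : ((u ^ (-(p * q : ℤ)) : Bˣ) : B) * ((u ^ (p * q : ℤ) : Bˣ) : B) = 1 := by
    rw [← Units.val_mul, ← zpow_add, neg_add_cancel, zpow_zero, Units.val_one]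
  rw [mul_pow, mul_pow, h1, h2, Units.val_mul]
  linear_combination h + (s : B) * (x ^ p + y ^ q) * h3

theorem nonempty_algEquiv_of_lift {A B : Type*} [CommRing A] [Algebra ℂ A] [CommRing B]
    [Algebra ℂ B] {x y : A} {τ υ : Aˣ} {x' y' : B} {σ ω : Bˣ}
    (hA : (τ : A) * (x ^ p + y ^ q) = 1) (hB : (σ : B) ^ ℓ * (x' ^ p + y' ^ q) = 1)
    (liftA : ∀ (a b : B) (t u : Bˣ), (t : B) * (a ^ p + b ^ q) = 1 →
      ∃ f : A →ₐ[ℂ] B, f x = a ∧ f y = b ∧ f τ = t ∧ f υ = u)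
    (liftB : ∀ (a b : A) (t u : Aˣ), (t : A) ^ ℓ * (a ^ p + b ^ q) = 1 →
      ∃ f : B →ₐ[ℂ] A, f x' = a ∧ f y' = b ∧ f σ = t ∧ f ω = u)
    (extA : ∀ f : A →ₐ[ℂ] A, f x = x → f y = y → f τ = τ → f υ = υ → f = AlgHom.id ℂ A)
    (extB : ∀ f : B →ₐ[ℂ] B, f x' = x' → f y' = y' → f σ = σ → f ω = ω → f = AlgHom.id ℂ B)
    {c d : ℤ} (hcd : ℓ * d + p * q * c = 1) : Nonempty (A ≃ₐ[ℂ] B) := by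
  obtain ⟨ζ, hζ⟩ : ∃ ζ, ζ = τ ^ c * υ ^ (-ℓ : ℤ) := ⟨_, rfl⟩
  have e1 : (τ ^ d * υ ^ (p * q : ℤ)) ^ (ℓ : ℤ) = τ * ζ ^ (-(p * q : ℤ)) := by
    rw [hζ, mul_zpow, mul_zpow, ← zpow_mul, ← zpow_mul, ← zpow_mul, ← zpow_mul, ← mul_assoc,
      ← zpow_one_add]
    congr 2
    · linear_combination hcd
    · ring
  have e2 : (τ ^ d * υ ^ (p * q : ℤ)) ^ c * (τ ^ (-c) * υ ^ (ℓ : ℤ)) ^ d = υ := by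
    rw [zpow_mul_zpow_mul_zpow_mul_zpow, show (p * q : ℤ) * c + ℓ * d = 1 by linear_combination hcd,
      show d * c + -c * d = 0 by ring, zpow_one, zpow_zero, one_mul]
  have e2' : ζ⁻¹ = τ ^ (-c) * υ ^ (ℓ : ℤ) := by
    rw [hζ, mul_inv, zpow_neg, zpow_neg, inv_inv]
  have e3 : (τ ^ d * υ ^ (p * q : ℤ)) ^ (ℓ : ℤ) * ζ⁻¹ ^ (-(p * q : ℤ)) = τ := by
    rw [e1, inv_zpow, mul_inv_cancel_right]
  rw [← e2'] at e2
  have e4 : (σ ^ (ℓ : ℤ) * ω ^ (-(p * q : ℤ))) ^ d * (σ ^ c * ω ^ d) ^ (p * q : ℤ) = σ := by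
    rw [zpow_mul_zpow_mul_zpow_mul_zpow, show ℓ * d + c * (p * q) = 1 by linear_combination hcd,
      show -(p * q : ℤ) * d + d * (p * q) = 0 by ring, zpow_one, zpow_zero, mul_one]
  have e5 : (σ ^ (ℓ : ℤ) * ω ^ (-(p * q : ℤ))) ^ c * (σ ^ c * ω ^ d) ^ (-ℓ : ℤ) = ω⁻¹ := by
    rw [zpow_mul_zpow_mul_zpow_mul_zpow,
      show -(p * q : ℤ) * c + d * -ℓ = -1 by linear_combination -hcd,
      show (ℓ : ℤ) * c + c * -ℓ = 0 by ring, zpow_neg_one, zpow_zero, one_mul]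
  obtain ⟨f, fx, fy, fτ, fυ⟩ := liftA (x' * (ω ^ (q : ℤ) : Bˣ)) (y' * (ω ^ (p : ℤ) : Bˣ))
    (σ ^ (ℓ : ℤ) * ω ^ (-(p * q : ℤ))) (σ ^ c * ω ^ d)
    (relation_of_scaling (by rw [zpow_natCast, Units.val_pow_eq_pow_val, hB]) ω)
  obtain ⟨g, gx, gy, gσ, gω⟩ := liftB (x * (ζ ^ (q : ℤ) : Aˣ)) (y * (ζ ^ (p : ℤ) : Aˣ))
    (τ ^ d * υ ^ (p * q : ℤ)) ζ⁻¹
    (by rw [← Units.val_pow_eq_pow_val, ← zpow_natCast, e1]; exact relation_of_scaling hA ζ)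
  have fζ : f ζ = ((ω⁻¹ : Bˣ) : B) := by
    rw [hζ, ← e5]
    exact (f : A →+* B).map_units_zpow_mul_zpow fτ fυ c (-ℓ)
  have fζn : ∀ n : ℤ, f (ζ ^ n : Aˣ) = ((ω⁻¹ ^ n : Bˣ) : B) := fun n ↦ by
    simpa only [zpow_zero, mul_one, RingHom.coe_coe] using
      (f : A →+* B).map_units_zpow_mul_zpow fζ fζ n 0
  have gωn : ∀ n : ℤ, g (ω ^ n : Bˣ) = ((ζ⁻¹ ^ n : Aˣ) : A) := fun n ↦ by
    simpa only [zpow_zero, mul_one, RingHom.coe_coe] using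
      (g : B →+* A).map_units_zpow_mul_zpow gω gω n 0
  have fζ' : f (ζ⁻¹ : Aˣ) = (ω : B) := by
    simpa only [zpow_neg_one, inv_inv] using fζn (-1)
  refine ⟨AlgEquiv.ofAlgHom f g (extB _ ?_ ?_ ?_ ?_) (extA _ ?_ ?_ ?_ ?_)⟩
  · rw [AlgHom.comp_apply, gx, map_mul, fx, fζn, mul_assoc, ← Units.val_mul, ← mul_zpow,
      mul_inv_cancel, one_zpow, Units.val_one, mul_one]
  · rw [AlgHom.comp_apply, gy, map_mul, fy, fζn, mul_assoc, ← Units.val_mul, ← mul_zpow,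
      mul_inv_cancel, one_zpow, Units.val_one, mul_one]
  · rw [AlgHom.comp_apply, gσ]
    exact ((f : A →+* B).map_units_zpow_mul_zpow fτ fυ _ _).trans (congrArg _ e4)
  · rw [AlgHom.comp_apply, gω, fζ']
  · rw [AlgHom.comp_apply, fx, map_mul, gx, gωn, mul_assoc, ← Units.val_mul, ← mul_zpow,
      mul_inv_cancel, one_zpow, Units.val_one, mul_one]
  · rw [AlgHom.comp_apply, fy, map_mul, gy, gωn, mul_assoc, ← Units.val_mul, ← mul_zpow,
      mul_inv_cancel, one_zpow, Units.val_one, mul_one]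
  · rw [AlgHom.comp_apply, fτ]
    exact ((g : B →+* A).map_units_zpow_mul_zpow gσ gω _ _).trans (congrArg _ e3)
  · rw [AlgHom.comp_apply, fυ]
    exact ((g : B →+* A).map_units_zpow_mul_zpow gσ gω _ _).trans (congrArg _ e2)

theorem exists_laurent_lift {B : Type*} [CommRing B] [Algebra ℂ B] (x y : B) (t u : Bˣ)
    (h : (t : B) ^ ℓ * (x ^ p + y ^ q) = 1) :
    ∃ f : LaurentPolynomial (surfaceRingPQ p q ℓ) →ₐ[ℂ] B, f (C (coord p q ℓ 0)) = x ∧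
      f (C (coord p q ℓ 1)) = y ∧ f (C (coord p q ℓ 2)) = t ∧ f (T 1) = u :=
  ⟨laurentLift x y t u h, by simp⟩

theorem nonempty_laurent_algEquiv (hℓ : ℓ ≠ 0) {c d : ℤ} (hcd : ℓ * d + p * q * c = 1) :
    Nonempty (LaurentPolynomial (surfaceRingPQ p q 1) ≃ₐ[ℂ]
      LaurentPolynomial (surfaceRingPQ p q ℓ)) := by
  have hC : ∀ k, (C (coord p q k 2) : LaurentPolynomial (surfaceRingPQ p q k)) ^ k *
      (C (coord p q k 0) ^ p + C (coord p q k 1) ^ q) = 1 := fun k ↦ by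
    rw [← map_pow, ← map_pow, ← map_pow, ← map_add, ← map_mul, relation, map_one]
  have units : ∀ k, k ≠ 0 → ∃ t u : (LaurentPolynomial (surfaceRingPQ p q k))ˣ,
      (t : LaurentPolynomial (surfaceRingPQ p q k)) = C (coord p q k 2) ∧
      (u : LaurentPolynomial (surfaceRingPQ p q k)) = T 1 := fun k hk ↦
    ⟨_, _, IsUnit.unit_spec ((isUnit_coord_two hk).map C),
      IsUnit.unit_spec (isUnit_T 1)⟩
  obtain ⟨τ, υ, hτ, hυ⟩ := units 1 one_ne_zero
  obtain ⟨σ, ω, hσ, hω⟩ := units ℓ hℓ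
  refine nonempty_algEquiv_of_lift (p := p) (q := q) (ℓ := ℓ) (x := C (coord p q 1 0))
    (y := C (coord p q 1 1)) (x' := C (coord p q ℓ 0)) (y' := C (coord p q ℓ 1))
    (τ := τ) (υ := υ) (σ := σ) (ω := ω)
    ?_ ?_ (fun a b t u h ↦ ?_) (fun a b t u h ↦ ?_) (fun f hx hy ht hu ↦ ?_)
    (fun f hx hy ht hu ↦ ?_) hcd
  · rw [hτ]
    linear_combination hC 1
  · rw [hσ, hC]
  · rw [hτ, hυ]
    exact exists_laurent_lift a b t u (by rw [pow_one, h])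
  · rw [hσ, hω]
    exact exists_laurent_lift a b t u h
  · rw [hτ] at ht
    rw [hυ] at hu
    exact laurent_algHom_ext (B := LaurentPolynomial (surfaceRingPQ p q 1)) hx hy ht hu
  · rw [hσ] at ht
    rw [hω] at hu
    exact laurent_algHom_ext (B := LaurentPolynomial (surfaceRingPQ p q ℓ)) hx hy ht hu

end surfaceRingPQ

/-- **Theorem (main theorem for surfaces).** Let `p ≥ 2` be prime, `q ≥ 3` coprime with
`p`, and `ℓ ≥ 2` coprime with `pq` with `ℓ ≢ ±1 (mod pq)`.  Then the surfaces
`{t(x^p + y^q) = 1}` and `{t^ℓ(x^p + y^q) = 1}` are not isomorphic, although their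
`ℂ*`-cylinders are: the `ℂ`-algebras `A₁` and `A_ℓ` are not isomorphic, but
`A₁[u,u⁻¹]` and `A_ℓ[u,u⁻¹]` are isomorphic. -/
theorem surfacesPQ_laurent_cancellation_fails (p q ℓ : ℕ)
    (hp : p.Prime) (hq : 3 ≤ q) (hpq : Nat.gcd p q = 1)
    (hℓ : 2 ≤ ℓ) (hℓpq : Nat.gcd ℓ (p * q) = 1)
    (h1 : ¬ ((ℓ : ℤ) ≡ 1 [ZMOD (p * q : ℕ)]))
    (h2 : ¬ ((ℓ : ℤ) ≡ -1 [ZMOD (p * q : ℕ)])) :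
    (¬ Nonempty (surfaceRingPQ p q 1 ≃ₐ[ℂ] surfaceRingPQ p q ℓ)) ∧
    Nonempty (LaurentPolynomial (surfaceRingPQ p q 1) ≃ₐ[ℂ]
      LaurentPolynomial (surfaceRingPQ p q ℓ)) := by
  have hℓ0 : ℓ ≠ 0 := by omega
  refine ⟨fun ⟨φ⟩ ↦ ?_, ?_⟩
  · exact (surfaceRingPQ.modEq_one_or_neg_one_of_algEquiv hp.two_le (by omega) hpq hℓ0 φ.symm).elim
      h1 h2
  · have h := Nat.gcd_eq_gcd_ab ℓ (p * q)
    rw [hℓpq, Nat.cast_one, Nat.cast_mul] at h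
    exact surfaceRingPQ.nonempty_laurent_algEquiv hℓ0 h.symm
end
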